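/- arXiv:math/0411420 — 12 statements merged into one kernel-verified Lean document; each statement's English description precedes it below -/
import Mathlib

section
/- Let n ≥ 1, let z be an n×n complex unitary matrix (z⋆z = 1), and let g = [[a,b],[c,d]] be an (n+n)×(n+n) complex block matrix (with n×n blocks) belonging to U(n,n), i.e. satisfying g⋆ · diag(1ₙ, −1ₙ) · g = diag(1ₙ, −1ₙ). Then the matrix a + z·c is invertible and the matrix z^[g] := (a+zc)⁻¹(b+zd) is unitary. -/
open Matrix

/-- For `z` unitary and `g = [[a,b],[c,d]] ∈ U(n,n)`, the matrix `a + z·c` is invertible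
and `z^[g] = (a+zc)⁻¹(b+zd)` is unitary. -/
theorem stmt0 (n : ℕ) (hn : 1 ≤ n)
    (z a b c d : Matrix (Fin n) (Fin n) ℂ)
    (hz : zᴴ * z = 1)
    (hg : (fromBlocks a b c d)ᴴ * fromBlocks 1 0 0 (-1) * fromBlocks a b c d
        = fromBlocks (1 : Matrix (Fin n) (Fin n) ℂ) 0 0 (-1)) :
    IsUnit (a + z * c) ∧
      ((a + z * c)⁻¹ * (b + z * d))ᴴ * ((a + z * c)⁻¹ * (b + z * d)) = 1 := by
  have hJ : (fromBlocks (1 : Matrix (Fin n) (Fin n) ℂ) 0 0 (-1 : Matrix (Fin n) (Fin n) ℂ)) *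
      fromBlocks (1 : Matrix (Fin n) (Fin n) ℂ) 0 0 (-1 : Matrix (Fin n) (Fin n) ℂ) = 1 := by
    simp [fromBlocks_multiply]
  have h1 : (fromBlocks (1 : Matrix (Fin n) (Fin n) ℂ) 0 0 (-1 : Matrix (Fin n) (Fin n) ℂ) * ((fromBlocks a b c d)ᴴ *
      fromBlocks (1 : Matrix (Fin n) (Fin n) ℂ) 0 0 (-1 : Matrix (Fin n) (Fin n) ℂ))) * fromBlocks a b c d = 1 := by
    rw [Matrix.mul_assoc, hg, hJ]
  have h2 := mul_eq_one_comm.mp h1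
  simp only [fromBlocks_conjTranspose, fromBlocks_multiply, ← fromBlocks_one,
    fromBlocks_inj] at h2
  simp only [Matrix.one_mul, Matrix.mul_one, Matrix.zero_mul, Matrix.mul_zero, add_zero,
    zero_add, Matrix.neg_mul, Matrix.mul_neg, neg_neg, neg_zero] at h2
  obtain ⟨e1, e2, e3, e4⟩ := h2
  have hz' : z * zᴴ = 1 := mul_eq_one_comm.mp hz
  have hA : a * aᴴ = 1 + b * bᴴ := by rw [← e1]; abel
  have hB : a * cᴴ = b * dᴴ := by
    have : a * cᴴ = -(-(a * cᴴ) + b * dᴴ) + b * dᴴ := by abel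
    rw [this, e2]; simp
  have hC : c * aᴴ = d * bᴴ := by
    have : c * aᴴ = (c * aᴴ + -(d * bᴴ)) + d * bᴴ := by abel
    rw [this, e3]; simp
  have hD : d * dᴴ = 1 + c * cᴴ := by rw [← e4]; abel
  have key : (a + z * c) * (a + z * c)ᴴ = (b + z * d) * (b + z * d)ᴴ := by
    have l : (a + z * c) * (a + z * c)ᴴ =
        a * aᴴ + a * cᴴ * zᴴ + z * (c * aᴴ) + z * (c * cᴴ) * zᴴ := by
      simp only [conjTranspose_add, conjTranspose_mul]; noncomm_ring
    have r : (b + z * d) * (b + z * d)ᴴ =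
        b * bᴴ + b * dᴴ * zᴴ + z * (d * bᴴ) + z * (d * dᴴ) * zᴴ := by
      simp only [conjTranspose_add, conjTranspose_mul]; noncomm_ring
    rw [l, r, hA, hB, hC, hD, Matrix.mul_add, Matrix.add_mul, Matrix.mul_one, hz']
    abel
  have one : a * (a + z * c)ᴴ - b * (b + z * d)ᴴ = 1 := by
    have : a * (a + z * c)ᴴ - b * (b + z * d)ᴴ =
        a * aᴴ - b * bᴴ + (a * cᴴ - b * dᴴ) * zᴴ := by
      simp only [conjTranspose_add, conjTranspose_mul]; noncomm_ring
    rw [this, hA, hB]; simp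
  generalize a + z * c = P at *
  generalize b + z * d = Q at *
  have hP : IsUnit P := by
    rw [← isUnit_conjTranspose, ← mulVec_injective_iff_isUnit]
    refine (injective_iff_map_eq_zero (Matrix.mulVecLin Pᴴ)).mpr ?_
    intro v hv
    rw [mulVecLin_apply] at hv
    have hq : Qᴴ *ᵥ v = 0 := by
      open scoped ComplexOrder in
      rw [← self_mul_conjTranspose_mulVec_eq_zero, ← key, ← mulVec_mulVec, hv, mulVec_zero]
    rw [← one_mulVec v, ← one, sub_mulVec, ← mulVec_mulVec, ← mulVec_mulVec, hv, hq]
    simp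
  refine ⟨hP, ?_⟩
  have hdet := (isUnit_iff_isUnit_det P).mp hP
  have hdet' : IsUnit Pᴴ.det :=
    (isUnit_iff_isUnit_det _).mp ((isUnit_conjTranspose (A := P)).mpr hP)
  rw [mul_eq_one_comm, conjTranspose_mul, conjTranspose_nonsing_inv]
  calc P⁻¹ * Q * (Qᴴ * (Pᴴ)⁻¹) = P⁻¹ * (Q * Qᴴ) * (Pᴴ)⁻¹ := by simp only [Matrix.mul_assoc]
    _ = (P⁻¹ * P) * (Pᴴ * (Pᴴ)⁻¹) := by rw [← key]; simp only [Matrix.mul_assoc]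
    _ = 1 := by rw [nonsing_inv_mul _ hdet, mul_nonsing_inv _ hdet', Matrix.one_mul]
end

section
/- Let n ≥ 1, let g = [[a,b],[c,d]] be an invertible (n+n)×(n+n) complex block matrix (with n×n blocks), and let z be an n×n complex matrix such that a + zc is invertible. Then the image of the graph V_z = { v ⊕ (v·z) : v ∈ ℂⁿ } under right multiplication by g, namely { (v·a + v·z·c) ⊕ (v·b + v·z·d) : v ∈ ℂⁿ }, equals the graph V_u of the matrix u = z^[g] := (a+zc)⁻¹(b+zd). -/
open Matrix

/-- The image of the graph `V_z = { v ⊕ v·z }` under right multiplication by an invertible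
block matrix `g = [[a,b],[c,d]]` (with `a + z·c` invertible) is the graph of
`z^[g] = (a+zc)⁻¹(b+zd)`. -/
theorem stmt2 (n : ℕ) (hn : 1 ≤ n)
    (a b c d z : Matrix (Fin n) (Fin n) ℂ)
    (hg : IsUnit (fromBlocks a b c d))
    (ha : IsUnit (a + z * c)) :
    {w : (Fin n → ℂ) × (Fin n → ℂ) |
        ∃ v : Fin n → ℂ, w = (v ᵥ* a + (v ᵥ* z) ᵥ* c, v ᵥ* b + (v ᵥ* z) ᵥ* d)}
      = {w : (Fin n → ℂ) × (Fin n → ℂ) |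
          ∃ v : Fin n → ℂ, w = (v, v ᵥ* ((a + z * c)⁻¹ * (b + z * d)))} := by
  have hdet : IsUnit (a + z * c).det := (Matrix.isUnit_iff_isUnit_det _).mp ha
  have h1 : ∀ (v : Fin n → ℂ) (p q : Matrix (Fin n) (Fin n) ℂ),
      v ᵥ* p + (v ᵥ* z) ᵥ* q = v ᵥ* (p + z * q) := by
    intro v p q
    rw [vecMul_vecMul, vecMul_add]
  ext w
  simp only [Set.mem_setOf_eq, h1]
  constructor
  · rintro ⟨v, rfl⟩
    refine ⟨v ᵥ* (a + z * c), ?_⟩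
    rw [vecMul_vecMul, ← Matrix.mul_assoc, Matrix.mul_nonsing_inv _ hdet, Matrix.one_mul]
  · rintro ⟨v, rfl⟩
    refine ⟨v ᵥ* (a + z * c)⁻¹, ?_⟩
    rw [vecMul_vecMul, vecMul_vecMul, Matrix.nonsing_inv_mul _ hdet, vecMul_one]
end

section
/- Let n ≥ 1 and let g = [[a,b],[c,d]] ∈ U(n,n). Then the block a is invertible and the operator norm of the matrix c·a⁻¹ (as an operator on the Hermitian space ℂⁿ) is strictly less than 1. -/
open Matrix

/-- For `g = [[a,b],[c,d]] ∈ U(n,n)`, the block `a` is invertible and the operator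
norm of `c·a⁻¹` on the Hermitian space `ℂⁿ` is strictly less than `1`. -/
theorem stmt5 (n : ℕ) (hn : 1 ≤ n)
    (a b c d : Matrix (Fin n) (Fin n) ℂ)
    (hg : (fromBlocks a b c d)ᴴ * fromBlocks 1 0 0 (-1) * fromBlocks a b c d
        = fromBlocks (1 : Matrix (Fin n) (Fin n) ℂ) 0 0 (-1)) :
    IsUnit a ∧ ‖Matrix.toEuclideanCLM (𝕜 := ℂ) (c * a⁻¹)‖ < 1 := by
  have h1 : aᴴ * a = 1 + cᴴ * c := by
    rw [fromBlocks_conjTranspose, fromBlocks_multiply, fromBlocks_multiply] at hg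
    have h := (fromBlocks_inj.1 hg).1
    simp only [Matrix.mul_one, Matrix.mul_zero, add_zero, zero_add, Matrix.mul_neg,
      Matrix.neg_mul] at h
    rw [← h]; abel
  have hu : IsUnit a := by
    open scoped ComplexOrder in
    have hp : (aᴴ * a).PosDef := by
      rw [h1]
      exact PosDef.one.add_posSemidef (posSemidef_conjTranspose_mul_self c)
    have h2 := hp.isUnit
    rw [isUnit_iff_isUnit_det, det_mul] at h2
    rw [isUnit_iff_isUnit_det]
    exact isUnit_of_mul_isUnit_right h2
  refine ⟨hu, ?_⟩
  have hdet := (isUnit_iff_isUnit_det a).1 hu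
  set T := Matrix.toEuclideanCLM (n := Fin n) (𝕜 := ℂ) with hT
  have h2 : star (T a) * T a = 1 + star (T c) * T c := by
    rw [← map_star, ← map_star, ← map_mul, ← map_mul, star_eq_conjTranspose,
      star_eq_conjTranspose, h1, map_add, map_one]
  have key : ∀ x, ‖T a x‖ ^ 2 = ‖x‖ ^ 2 + ‖T c x‖ ^ 2 := by
    intro x
    have h3 := congrArg (fun S => RCLike.re (inner ℂ (S x) x)) h2
    simp only [ContinuousLinearMap.star_eq_adjoint, ContinuousLinearMap.mul_apply,
      ContinuousLinearMap.add_apply, ContinuousLinearMap.one_apply, inner_add_left,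
      ContinuousLinearMap.adjoint_inner_left, map_add, inner_self_eq_norm_sq] at h3
    exact h3
  set K := ‖T a‖ + 1 with hK
  have hK1 : 1 ≤ K := by have := norm_nonneg (T a); linarith
  have hK2 : 0 < (K ^ 2)⁻¹ := by positivity
  have hK3 : (K ^ 2)⁻¹ ≤ 1 := inv_le_one_of_one_le₀ (one_le_pow₀ hK1)
  have hle : ‖T (c * a⁻¹)‖ ≤ Real.sqrt (1 - (K ^ 2)⁻¹) := by
    refine ContinuousLinearMap.opNorm_le_bound _ (Real.sqrt_nonneg _) fun y => ?_
    have e1 : T a (T a⁻¹ y) = y := by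
      rw [← ContinuousLinearMap.mul_apply, ← map_mul, mul_nonsing_inv _ hdet, map_one]
      rfl
    have e2 : T (c * a⁻¹) y = T c (T a⁻¹ y) := by
      rw [map_mul]; rfl
    have k := key (T a⁻¹ y)
    rw [e1, ← e2] at k
    have l : ‖y‖ ≤ K * ‖T a⁻¹ y‖ := by
      have := (T a).le_opNorm (T a⁻¹ y)
      rw [e1] at this
      have h0 := norm_nonneg (T a⁻¹ y)
      rw [hK]; linarith
    have l2 : (K ^ 2)⁻¹ * ‖y‖ ^ 2 ≤ ‖T a⁻¹ y‖ ^ 2 := by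
      rw [inv_mul_le_iff₀ (by positivity), ← mul_pow]
      gcongr
    refine (sq_le_sq₀ (norm_nonneg _) (by positivity)).1 ?_
    rw [mul_pow, Real.sq_sqrt (by linarith)]
    linarith
  refine hle.trans_lt ?_
  rw [Real.sqrt_lt' one_pos]
  linarith
end

section
/- Let n ≥ 1, let g = [[a,b],[c,d]] ∈ U(n,n), and let z, u be n×n unitary matrices (so that a+zc and a+uc are invertible). Then det(1 − z^[g] · (u^[g])⋆) = det(1 − z·u⋆) · det(a+zc)⁻¹ · conj(det(a+uc))⁻¹, where z^[g] = (a+zc)⁻¹(b+zd) and u^[g] = (a+uc)⁻¹(b+ud). -/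
open Matrix


theorem aux_rel {n : ℕ} (a b c d : Matrix (Fin n) (Fin n) ℂ)
    (hg : (fromBlocks a b c d)ᴴ * fromBlocks 1 0 0 (-1) * fromBlocks a b c d
        = fromBlocks (1 : Matrix (Fin n) (Fin n) ℂ) 0 0 (-1)) :
    a * aᴴ - b * bᴴ = 1 ∧ a * cᴴ - b * dᴴ = 0 ∧ c * aᴴ - d * bᴴ = 0 ∧ c * cᴴ - d * dᴴ = -1 := by
  have hJ : (fromBlocks 1 0 0 (-1) : Matrix (Fin n ⊕ Fin n) (Fin n ⊕ Fin n) ℂ) *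
      (fromBlocks 1 0 0 (-1) : Matrix (Fin n ⊕ Fin n) (Fin n ⊕ Fin n) ℂ) = 1 := by
    simp [fromBlocks_multiply]
  have h1 : ((fromBlocks 1 0 0 (-1) : Matrix (Fin n ⊕ Fin n) (Fin n ⊕ Fin n) ℂ) * (fromBlocks a b c d)ᴴ *
      (fromBlocks 1 0 0 (-1) : Matrix (Fin n ⊕ Fin n) (Fin n ⊕ Fin n) ℂ)) * fromBlocks a b c d = 1 := by
    rw [Matrix.mul_assoc, Matrix.mul_assoc, ← Matrix.mul_assoc (fromBlocks a b c d)ᴴ, hg, hJ]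
  have h2 := mul_eq_one_comm.mp h1
  simp only [fromBlocks_conjTranspose, fromBlocks_multiply, ← fromBlocks_one, fromBlocks_inj] at h2
  simp only [Matrix.mul_one, Matrix.one_mul, Matrix.mul_zero, Matrix.zero_mul, add_zero, zero_add,
    Matrix.mul_neg, Matrix.neg_mul, neg_neg] at h2
  obtain ⟨e1, e2, e3, e4⟩ := h2
  refine ⟨by rw [sub_eq_add_neg]; exact e1, ?_, by rw [sub_eq_add_neg]; exact e3, ?_⟩
  · rw [← neg_eq_zero, ← e2]; abel
  · rw [← e4]; abel

theorem aux_key {n : ℕ} (a b c d z u : Matrix (Fin n) (Fin n) ℂ)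
    (hg : (fromBlocks a b c d)ᴴ * fromBlocks 1 0 0 (-1) * fromBlocks a b c d
        = fromBlocks (1 : Matrix (Fin n) (Fin n) ℂ) 0 0 (-1)) :
    (a + z * c) * (a + u * c)ᴴ - (b + z * d) * (b + u * d)ᴴ = 1 - z * uᴴ := by
  obtain ⟨e1, e2, e3, e4⟩ := aux_rel a b c d hg
  have : (a + z * c) * (a + u * c)ᴴ - (b + z * d) * (b + u * d)ᴴ
      = (a * aᴴ - b * bᴴ) + (a * cᴴ - b * dᴴ) * uᴴ + z * (c * aᴴ - d * bᴴ)
        + z * (c * cᴴ - d * dᴴ) * uᴴ := by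
    simp only [conjTranspose_add, conjTranspose_mul]
    noncomm_ring
  rw [this, e1, e2, e3, e4]
  noncomm_ring

open scoped ComplexOrder in
theorem aux_unit {n : ℕ} (a b c d z : Matrix (Fin n) (Fin n) ℂ)
    (hg : (fromBlocks a b c d)ᴴ * fromBlocks 1 0 0 (-1) * fromBlocks a b c d
        = fromBlocks (1 : Matrix (Fin n) (Fin n) ℂ) 0 0 (-1)) (hz : zᴴ * z = 1) :
    (a + z * c).det ≠ 0 := by
  intro h0
  obtain ⟨v, hv, hv0⟩ := Matrix.exists_vecMul_eq_zero_iff.mpr h0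
  obtain ⟨e1, e2, e3, e4⟩ := aux_rel a b c d hg
  have hk := aux_key a b c d z z hg
  rw [mul_eq_one_comm.mp hz, sub_self, sub_eq_zero] at hk
  have hq : v ᵥ* (b + z * d) = 0 := by
    rw [← vecMul_self_mul_conjTranspose_eq_zero, ← hk, ← vecMul_vecMul, hv0, zero_vecMul]
  have h1 : (a + z * c) * aᴴ - (b + z * d) * bᴴ = 1 := by
    have : (a + z * c) * aᴴ - (b + z * d) * bᴴ
      = (a * aᴴ - b * bᴴ) + z * (c * aᴴ - d * bᴴ) := by noncomm_ring
    rw [this, e1, e3]; simp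
  apply hv
  rw [← vecMul_one v, ← h1, vecMul_sub, ← vecMul_vecMul, ← vecMul_vecMul, hv0, hq]
  simp

/-- The determinant identity
`det(1 − z^[g](u^[g])⋆) = det(1 − zu⋆)·det(a+zc)⁻¹·conj(det(a+uc))⁻¹`
for `g = [[a,b],[c,d]] ∈ U(n,n)` and `z, u` unitary. -/
theorem stmt6 (n : ℕ) (hn : 1 ≤ n)
    (a b c d z u : Matrix (Fin n) (Fin n) ℂ)
    (hg : (fromBlocks a b c d)ᴴ * fromBlocks 1 0 0 (-1) * fromBlocks a b c d
        = fromBlocks (1 : Matrix (Fin n) (Fin n) ℂ) 0 0 (-1))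
    (hz : zᴴ * z = 1) (hu : uᴴ * u = 1) :
    (1 - ((a + z * c)⁻¹ * (b + z * d)) * ((a + u * c)⁻¹ * (b + u * d))ᴴ).det
      = (1 - z * uᴴ).det * ((a + z * c).det)⁻¹ * ((starRingEnd ℂ) ((a + u * c).det))⁻¹ := by
  have hP := aux_unit a b c d z hg hz
  have hR := aux_unit a b c d u hg hu
  have hk := aux_key a b c d z u hg
  generalize a + z * c = P at *
  generalize a + u * c = R at *
  generalize b + z * d = Q at *
  generalize b + u * d = S at *
  have hR' : (Rᴴ).det ≠ 0 := by
    rw [det_conjTranspose]; exact star_ne_zero.mpr hR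
  have h : P * (1 - (P⁻¹ * Q) * (R⁻¹ * S)ᴴ) * Rᴴ = 1 - z * uᴴ := by
    rw [← hk, conjTranspose_mul, conjTranspose_nonsing_inv, Matrix.mul_sub, Matrix.sub_mul]
    congr 1
    · simp
    · simp only [Matrix.mul_assoc]
      rw [nonsing_inv_mul _ (isUnit_iff_ne_zero.mpr hR'), Matrix.mul_one,
        mul_nonsing_inv_cancel_left _ _ (isUnit_iff_ne_zero.mpr hP)]
  have hd := congrArg det h
  rw [det_mul, det_mul] at hd
  have e : (starRingEnd ℂ) R.det = (Rᴴ).det := by rw [det_conjTranspose]; rfl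
  rw [e, ← hd]
  field_simp
end

section
/- Let σ, τ ∈ ℝ with σ + τ > −1 and let λ ∈ ℤ. Then ∫₀^{2π} (1−e^{iφ})^σ · (1−e^{−iφ})^τ · e^{iλφ} dφ = 2π·(−1)^λ · Γ(σ+τ+1) / ( Γ(τ+1−λ) · Γ(σ+1+λ) ), where the complex powers are principal-branch complex powers, Γ is the real Gamma function (which vanishes at nonpositive integers, in which case the right-hand side is interpreted as 0 via division by zero), and the right-hand side is viewed as a complex number. -/
open Real

noncomputable def cauF (a b : ℝ) : ℝ := ∫ θ in (-(π/2))..(π/2), (2 * Real.cos θ) ^ a * Real.cos (b * θ)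

lemma beta_real (s : ℝ) (hs : 0 < s) :
    ∫ t in (0:ℝ)..1, (t * (1 - t)) ^ (s - 1) = Real.Gamma s * Real.Gamma s / Real.Gamma (2 * s) := by
  have h := Complex.betaIntegral_eq_Gamma_mul_div (s:ℂ) (s:ℂ) (by simpa) (by simpa)
  rw [Complex.betaIntegral] at h
  apply Complex.ofReal_injective
  rw [← intervalIntegral.integral_ofReal]
  push_cast
  rw [← Complex.Gamma_ofReal, ← Complex.Gamma_ofReal]
  push_cast
  rw [two_mul, ← h]
  apply intervalIntegral.integral_congr
  intro t ht
  rw [Set.uIcc_of_le zero_le_one] at ht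
  obtain ⟨h0, h1⟩ := ht
  have h1' : 0 ≤ 1 - t := by linarith
  simp only
  rw [Real.mul_rpow h0 h1']
  push_cast [Complex.ofReal_cpow h0, Complex.ofReal_cpow h1']
  rfl

lemma cauF_zero (a : ℝ) (ha : -1 < a) :
    ∫ θ in (-(π/2))..(π/2), (2 * Real.cos θ) ^ a
      = π * Real.Gamma (a + 1) / (Real.Gamma (a/2 + 1)) ^ 2 := by
  have hpi := Real.pi_pos
  have hle : -(π/2) ≤ π/2 := by linarith
  set s := (a+1)/2 with hs
  have hspos : 0 < s := by rw [hs]; linarith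
  have key := intervalIntegral.integral_comp_mul_deriv_of_deriv_nonneg (a := -(π/2)) (b := π/2)
    (f := fun θ => (1 + Real.sin θ)/2) (f' := fun θ => Real.cos θ / 2)
    (g := fun t => (t * (1 - t)) ^ (s - 1)) (by fun_prop)
    (by intro x _
        exact ((Real.hasDerivAt_sin x).const_add 1).div_const 2)
    (by intro x hx
        rw [min_eq_left hle, max_eq_right hle] at hx
        have := Real.cos_pos_of_mem_Ioo hx
        positivity)
  simp only [Real.sin_neg, Real.sin_pi_div_two] at key
  norm_num at key
  rw [beta_real s hspos] at key
  have e : ∫ θ in (-(π/2))..(π/2), (2 * Real.cos θ) ^ a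
      = 4 ^ a * (Real.Gamma s * Real.Gamma s / Real.Gamma (2 * s)) := by
    rw [← key, ← intervalIntegral.integral_const_mul]
    apply intervalIntegral.integral_congr_ae
    have : ∀ᵐ x : ℝ, x ≠ π/2 := by simp [MeasureTheory.ae_iff]
    filter_upwards [this] with x hx hx'
    rw [Set.uIoc_of_le hle] at hx'
    have hc : 0 < Real.cos x := Real.cos_pos_of_mem_Ioo ⟨hx'.1, lt_of_le_of_ne hx'.2 hx⟩
    have e1 : (1 + Real.sin x)/2 * (1 - (1 + Real.sin x)/2) = (Real.cos x/2)^(2:ℝ) := by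
      rw [Real.rpow_two]; nlinarith [Real.sin_sq_add_cos_sq x]
    rw [e1, ← Real.rpow_mul (by positivity)]
    have e2 : 2 * (s-1) = a - 1 := by rw [hs]; ring
    rw [e2, Real.rpow_sub_one (by positivity), div_mul_cancel₀ _ (by positivity),
      ← Real.mul_rpow (by norm_num) (by positivity)]
    congr 1; ring
  rw [e]
  have d := Real.Gamma_mul_Gamma_add_half s
  have e3 : s + 1/2 = a/2+1 := by rw [hs]; ring
  have e4 : 2 * s = a + 1 := by rw [hs]; ring
  have e5 : 1 - (a+1) = -a := by ring
  rw [e3, e4, e5] at d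
  rw [e4]
  have g1 : 0 < Real.Gamma (a/2+1) := Real.Gamma_pos_of_pos (by linarith)
  have g2 : 0 < Real.Gamma (a+1) := Real.Gamma_pos_of_pos (by linarith)
  have e6 : (4:ℝ)^a * ((2:ℝ)^(-a))^2 = 1 := by
    rw [← Real.rpow_natCast, ← Real.rpow_mul (by norm_num), show (4:ℝ) = (2:ℝ)^(2:ℝ) by norm_num,
      ← Real.rpow_mul (by norm_num), ← Real.rpow_add (by norm_num)]
    rw [show 2 * a + -a * ((2:ℕ):ℝ) = 0 by push_cast; ring, Real.rpow_zero]
  have e7 : √π ^ 2 = π := Real.sq_sqrt hpi.le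
  rw [eq_div_iff (by positivity), ← mul_div_assoc, div_mul_eq_mul_div, div_eq_iff g2.ne']
  calc _ = 4^a * (Real.Gamma s * Real.Gamma (a/2+1))^2 := by ring
    _ = (4^a * ((2:ℝ)^(-a))^2) * √π ^ 2 * Real.Gamma (a+1)^2 := by rw [d]; ring
    _ = _ := by rw [e6, e7]; ring

lemma cos_rpow_int (a : ℝ) (ha : -1 < a) :
    IntervalIntegrable (fun θ => (2 * Real.cos θ) ^ a) MeasureTheory.volume (-(π/2)) (π/2) := by
  by_contra hn
  have h0 := intervalIntegral.integral_undef hn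
  rw [cauF_zero a ha] at h0
  have g1 : 0 < Real.Gamma (a/2+1) := Real.Gamma_pos_of_pos (by linarith)
  have g2 : 0 < Real.Gamma (a+1) := Real.Gamma_pos_of_pos (by linarith)
  have hpi := Real.pi_pos
  have : 0 < π * Real.Gamma (a + 1) / (Real.Gamma (a/2 + 1)) ^ 2 := by positivity
  linarith

lemma cauF_int (a b : ℝ) (ha : -1 < a) :
    IntervalIntegrable (fun θ => (2 * Real.cos θ) ^ a * Real.cos (b * θ)) MeasureTheory.volume (-(π/2)) (π/2) :=
  (cos_rpow_int a ha).mul_continuousOn (by fun_prop)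

lemma cauF_rec1 (a c : ℝ) (ha : -1 < a) :
    (a+1+c) * cauF a (c+1) = (a+1-c) * cauF a (c-1) := by
  have hpi := Real.pi_pos
  have hle : -(π/2) ≤ π/2 := by linarith
  have i1 := (cauF_int a (c+1) ha).const_mul (a+1+c)
  have i2 := (cauF_int a (c-1) ha).const_mul (a+1-c)
  have := intervalIntegral.integral_eq_sub_of_hasDerivAt_of_le (a := -(π/2)) (b := π/2)
    (f := fun θ => (2 * Real.cos θ) ^ (a+1) * Real.sin (c * θ))
    (f' := fun θ => (a+1+c) * ((2 * Real.cos θ) ^ a * Real.cos ((c+1) * θ))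
        - (a+1-c) * ((2 * Real.cos θ) ^ a * Real.cos ((c-1) * θ))) hle
    (by
      apply Continuous.continuousOn
      refine Continuous.mul ?_ (by fun_prop)
      exact Continuous.rpow_const (by fun_prop) (fun x => Or.inr (by linarith)))
    (by
      intro x hx
      have hc : 0 < Real.cos x := Real.cos_pos_of_mem_Ioo hx
      have h1 : HasDerivAt (fun θ => (2 * Real.cos θ) ^ (a+1)) (2 * (-Real.sin x) * (a+1) * (2 * Real.cos x)^(a+1-1)) x :=
        ((Real.hasDerivAt_cos x).const_mul 2).rpow_const (Or.inl (by positivity))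
      have h2 : HasDerivAt (fun θ => Real.sin (c * θ)) (Real.cos (c*x) * (c * 1)) x :=
        ((hasDerivAt_id x).const_mul c).sin
      refine (h1.mul h2).congr_deriv ?_
      rw [Real.rpow_add_one (by positivity), add_sub_cancel_right, add_mul c 1 x, sub_mul c 1 x, one_mul, Real.cos_add, Real.cos_sub]
      ring)
    (i1.sub i2)
  rw [intervalIntegral.integral_sub i1 i2, intervalIntegral.integral_const_mul, intervalIntegral.integral_const_mul] at this
  have hz : (0:ℝ)^(a+1) = 0 := Real.zero_rpow (by linarith)
  simp only [Real.cos_neg, Real.cos_pi_div_two, mul_zero, hz, zero_mul, sub_zero] at this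
  unfold cauF
  linarith

lemma cauF_add (a b : ℝ) (ha : -1 < a) : cauF (a+1) b = cauF a (b+1) + cauF a (b-1) := by
  unfold cauF
  have hpi := Real.pi_pos
  have hle : -(π/2) ≤ π/2 := by linarith
  rw [← intervalIntegral.integral_add (cauF_int a _ ha) (cauF_int a _ ha)]
  apply intervalIntegral.integral_congr_ae
  have : ∀ᵐ x : ℝ, x ≠ π/2 := by simp [MeasureTheory.ae_iff]
  filter_upwards [this] with x hx hx'
  rw [Set.uIoc_of_le hle] at hx'
  have hc : 0 < Real.cos x := Real.cos_pos_of_mem_Ioo ⟨hx'.1, lt_of_le_of_ne hx'.2 hx⟩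
  rw [Real.rpow_add_one (by positivity), add_mul, sub_mul, one_mul, Real.cos_add, Real.cos_sub]
  ring

noncomputable def FF (p q : ℝ) : ℝ := cauF (p+q) (p-q)
noncomputable def GG (p q : ℝ) : ℝ := Real.Gamma (p+q+1) / (Real.Gamma (p+1) * Real.Gamma (q+1))

lemma FF_symm (p q : ℝ) : FF p q = FF q p := by
  unfold FF cauF
  rw [add_comm q p]
  congr 1; ext θ
  rw [← Real.cos_neg ((p-q)*θ)]; congr 2; ring

lemma GG_symm (p q : ℝ) : GG p q = GG q p := by
  unfold GG; rw [add_comm q p, mul_comm]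

lemma FF_rec (p q : ℝ) (h : -1 < p + q) : (q+1) * FF p (q+1) = (p+q+1) * FF p q := by
  unfold FF
  have h1 := cauF_rec1 (p+q) (p-q-1) h
  have h2 := cauF_add (p+q) (p-q-1) h
  have e1 : p - q - 1 + 1 = p - q := by ring
  have e2 : p + (q+1) = p+q+1 := by ring
  have e3 : p - (q+1) = p-q-1 := by ring
  rw [e1] at h1 h2
  rw [e2, e3, h2]
  linear_combination (-1/2) * h1

lemma inv_Gamma (s : ℝ) : (Real.Gamma s)⁻¹ = s * (Real.Gamma (s+1))⁻¹ := by
  rcases ne_or_eq s 0 with (h | rfl)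
  · rw [Real.Gamma_add_one h, mul_inv, mul_inv_cancel_left₀ h]
  · rw [zero_add, Real.Gamma_zero, inv_zero, zero_mul]

lemma GG_rec (p q : ℝ) (h : -1 < p + q) : (q+1) * GG p (q+1) = (p+q+1) * GG p q := by
  unfold GG
  rw [div_eq_mul_inv, div_eq_mul_inv, mul_inv, mul_inv, inv_Gamma (q+1), ← add_assoc p q 1,
    Real.Gamma_add_one (s := p+q+1) (by linarith)]
  ring

lemma reduce (p q : ℝ) (h : -1 < p + q) (n : ℕ) (hn : FF p (q+n) = π * GG p (q+n)) :
    FF p q = π * GG p q := by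
  induction n with
  | zero => simpa using hn
  | succ n ih =>
    apply ih
    have hp : -1 < p + (q + n) := by have : (0:ℝ) ≤ n := n.cast_nonneg
                                     linarith
    have h1 := FF_rec p (q+n) hp
    have h2 := GG_rec p (q+n) hp
    push_cast at hn
    rw [← add_assoc] at hn
    have h3 : (p + (q+n) + 1) ≠ 0 := by linarith
    apply mul_left_cancel₀ h3
    rw [← h1, hn]
    linear_combination π * h2


lemma cauF_zero' (a : ℝ) (ha : -1 < a) : cauF a 0 = π * Real.Gamma (a + 1) / (Real.Gamma (a/2 + 1)) ^ 2 := by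
  rw [← cauF_zero a ha]; simp [cauF]

lemma cauF_zero_pos (a : ℝ) (ha : -1 < a) : 0 < cauF a 0 := by
  rw [cauF_zero' a ha]
  have g1 : 0 < Real.Gamma (a/2+1) := Real.Gamma_pos_of_pos (by linarith)
  have g2 : 0 < Real.Gamma (a+1) := Real.Gamma_pos_of_pos (by linarith)
  have hpi := Real.pi_pos
  positivity

lemma cauF_zero_step (a : ℝ) (ha : -1 < a) : cauF (a+2) 0 = 4 * (a+1)/(a+2) * cauF a 0 := by
  rw [cauF_zero' a ha, cauF_zero' (a+2) (by linarith)]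
  have g1 : 0 < Real.Gamma (a/2+1) := Real.Gamma_pos_of_pos (by linarith)
  have e1 : a + 2 + 1 = (a + 1 + 1) + 1 := by ring
  have e2 : (a+2)/2 + 1 = (a/2+1) + 1 := by ring
  rw [e1, e2, Real.Gamma_add_one (s := a+1+1) (by linarith), Real.Gamma_add_one (s := a+1) (by linarith),
    Real.Gamma_add_one (s := a/2+1) (by linarith)]
  have h2 : a + 2 ≠ 0 := by linarith
  have h3 : a/2+1 ≠ 0 := by linarith
  field_simp
  ring

lemma cauF_bound (a b : ℝ) (ha : -1 < a) :
    |cauF a b - cauF a 0| ≤ b^2 * π^2 / 8 * (cauF a 0 / (a+2)) := by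
  have hpi := Real.pi_pos
  have hle : -(π/2) ≤ π/2 := by linarith
  have h2 : (0:ℝ) < a + 2 := by linarith
  have i1 := cauF_int a b ha
  have i0 := cauF_int a 0 ha
  have i2 := cauF_int (a+2) 0 (by linarith)
  have e : b^2 * π^2 / 8 * (cauF a 0 / (a+2)) = ∫ θ in (-(π/2))..(π/2),
      b^2 * π^2 / 8 * ((2 * Real.cos θ) ^ a * Real.cos (0 * θ) - 1/4 * ((2 * Real.cos θ) ^ (a+2) * Real.cos (0 * θ))) := by
    rw [intervalIntegral.integral_const_mul, intervalIntegral.integral_sub i0 (i2.const_mul _), intervalIntegral.integral_const_mul]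
    change _ = _ * (cauF a 0 - 1/4 * cauF (a+2) 0)
    rw [cauF_zero_step a ha]
    field_simp
    ring
  rw [e]
  unfold cauF
  rw [← intervalIntegral.integral_sub i1 i0, ← Real.norm_eq_abs]
  apply intervalIntegral.norm_integral_le_of_norm_le hle
  · have : ∀ᵐ x : ℝ, x ≠ π/2 := by simp [MeasureTheory.ae_iff]
    filter_upwards [this] with x hx hx'
    have hc : 0 < Real.cos x := Real.cos_pos_of_mem_Ioo ⟨hx'.1, lt_of_le_of_ne hx'.2 hx⟩
    have hr : (2 * Real.cos x)^(a+2) = (2 * Real.cos x)^a * (2 * Real.cos x)^2 := by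
      rw [Real.rpow_add (by positivity), Real.rpow_two]
    have hp : 0 < (2 * Real.cos x)^a := by positivity
    rw [hr, zero_mul, Real.cos_zero, Real.norm_eq_abs, ← mul_sub, abs_mul, abs_of_pos hp, abs_sub_comm,
      abs_of_nonneg (by linarith [Real.cos_le_one (b*x)])]
    have c1 : 1 - (b*x)^2/2 ≤ Real.cos (b*x) := Real.one_sub_sq_div_two_le_cos
    have hax : |x| ≤ π/2 := abs_le.2 ⟨hx'.1.le, hx'.2⟩
    have s1 := Real.mul_le_sin (abs_nonneg x) hax
    have s2 : (2/π * |x|)^2 ≤ Real.sin |x| ^2 := pow_le_pow_left₀ (by positivity) s1 2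
    have s3 : Real.sin |x| ^ 2 = 1 - Real.cos x ^ 2 := by rw [Real.sin_sq, Real.cos_abs]
    rw [s3, mul_pow, sq_abs] at s2
    have s4 : x^2 ≤ π^2/4 * (1 - Real.cos x^2) := by
      calc x^2 = π^2/4 * ((2/π)^2*x^2) := by field_simp; norm_num
        _ ≤ _ := by gcongr
    have s5 : 1 - Real.cos (b*x) ≤ b^2*π^2/8 * (1 - Real.cos x^2) := by
      nlinarith [mul_le_mul_of_nonneg_left s4 (sq_nonneg b)]
    calc _ ≤ (2 * Real.cos x)^a * (b^2*π^2/8 * (1 - Real.cos x^2)) := by gcongr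
      _ = _ := by ring
  · exact (i0.sub (i2.const_mul _)).const_mul _

open Filter Topology

lemma gamma_prod (s : ℝ) (hs : 0 < s) (n : ℕ) :
    (∏ j ∈ Finset.range (n+1), (s + j)) * Real.Gamma s = Real.Gamma (s + n + 1) := by
  induction n with
  | zero => simp [Real.Gamma_add_one hs.ne']
  | succ n ih =>
    rw [Finset.prod_range_succ, mul_right_comm, ih]
    have : s + n + 1 ≠ 0 := by positivity
    push_cast
    rw [← add_assoc, Real.Gamma_add_one this]
    ring

lemma gamma_tendsto (s : ℝ) (hs : 0 < s) :
    Tendsto (fun n : ℕ => Real.Gamma (s + n + 1) / ((n:ℝ)^s * n.factorial)) atTop (𝓝 1) := by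
  have g := Real.Gamma_pos_of_pos hs
  have h := (Real.GammaSeq_tendsto_Gamma s).inv₀ g.ne'
  have h2 := h.mul_const (Real.Gamma s)
  rw [inv_mul_cancel₀ g.ne'] at h2
  refine h2.congr (fun n => ?_)
  rw [Real.GammaSeq, ← gamma_prod s hs n, inv_div]
  ring

lemma gamma_ratio (p q : ℝ) (hp : 0 < p) (hq : 0 < q) :
    Tendsto (fun n : ℕ => Real.Gamma (p + n + 1) * Real.Gamma (q + n + 1) / Real.Gamma ((p+q)/2 + n + 1)^2)
      atTop (𝓝 1) := by
  have hx : 0 < (p+q)/2 := by positivity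
  have h := ((gamma_tendsto p hp).mul (gamma_tendsto q hq)).div ((gamma_tendsto _ hx).pow 2) (by norm_num)
  norm_num at h
  refine h.congr' ?_
  filter_upwards [eventually_ge_atTop 1] with n hn
  have hn' : (0:ℝ) < n := by exact_mod_cast hn
  have e : (n:ℝ)^p * (n:ℝ)^q = ((n:ℝ)^((p+q)/2))^2 := by
    rw [← Real.rpow_add hn', ← Real.rpow_natCast, ← Real.rpow_mul hn'.le]
    congr 1; push_cast; ring
  have g : 0 < Real.Gamma ((p+q)/2 + n + 1) := Real.Gamma_pos_of_pos (by positivity)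
  have k1 : (0:ℝ) < (n:ℝ)^p := by positivity
  have k2 : (0:ℝ) < (n:ℝ)^q := by positivity
  have k3 : (0:ℝ) < (n:ℝ)^((p+q)/2) := by positivity
  have k4 : (0:ℝ) < n.factorial := by positivity
  simp only [Pi.div_apply, Pi.mul_apply, Pi.pow_apply]
  rw [div_mul_div_comm, div_pow, div_div_div_eq,
    show (n:ℝ)^p * n.factorial * ((n:ℝ)^q * n.factorial) = ((n:ℝ)^((p+q)/2) * n.factorial)^2 by
      rw [mul_pow, ← e]; ring]
  rw [mul_comm (((n:ℝ)^((p+q)/2) * n.factorial)^2)]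
  exact mul_div_mul_right _ _ (by positivity)

lemma main_pos (p q : ℝ) (hp : 0 < p) (hq : 0 < q) : FF p q = π * GG p q := by
  have hpi := Real.pi_pos
  have Gpos : ∀ p q : ℝ, 0 < p → 0 < q → 0 < GG p q := by
    intro p q hp hq
    have g1 : 0 < Real.Gamma (p+q+1) := Real.Gamma_pos_of_pos (by linarith)
    have g2 : 0 < Real.Gamma (p+1) := Real.Gamma_pos_of_pos (by linarith)
    have g3 : 0 < Real.Gamma (q+1) := Real.Gamma_pos_of_pos (by linarith)
    unfold GG; positivity
  have step : ∀ p q : ℝ, 0 < p → 0 < q → FF p (q+1) / GG p (q+1) = FF p q / GG p q := by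
    intro p q hp hq
    have h1 := FF_rec p q (by linarith)
    have h2 := GG_rec p q (by linarith)
    rw [div_eq_div_iff (Gpos _ _ hp (by linarith)).ne' (Gpos _ _ hp hq).ne']
    have : (q+1) * (p+q+1) ≠ 0 := by positivity
    apply mul_left_cancel₀ this
    linear_combination (p+q+1) * GG p q * h1 - (p+q+1) * FF p q * h2
  have const : ∀ n : ℕ, FF (p+n) (q+n) / GG (p+n) (q+n) = FF p q / GG p q := by
    intro n
    induction n with
    | zero => simp
    | succ n ih =>
      rw [← ih]
      push_cast
      rw [← add_assoc, ← add_assoc, step _ _ (by positivity) (by positivity), FF_symm, GG_symm,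
        step _ _ (by positivity) (by positivity), FF_symm, GG_symm]
  set b := p - q with hb
  have lim1 : Tendsto (fun n : ℕ => cauF (p+q+2*n) b / cauF (p+q+2*n) 0) atTop (𝓝 1) := by
    rw [tendsto_iff_norm_sub_tendsto_zero]
    have l : Tendsto (fun n : ℕ => b^2*π^2/8 / (p+q+2*n+2)) atTop (𝓝 0) := by
      apply Tendsto.const_div_atTop
      apply tendsto_atTop_add_const_right
      apply tendsto_atTop_add_const_left
      exact Tendsto.const_mul_atTop (by norm_num) tendsto_natCast_atTop_atTop
    refine squeeze_zero (fun n => norm_nonneg _) (fun n => ?_) l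
    have ha : -1 < p+q+2*(n:ℝ) := by have : (0:ℝ) ≤ n := n.cast_nonneg
                                     linarith
    have c := cauF_zero_pos _ ha
    rw [Real.norm_eq_abs, div_sub_one c.ne', abs_div, abs_of_pos c, div_le_iff₀ c]
    refine (cauF_bound _ b ha).trans (le_of_eq ?_)
    ring
  have lim := lim1.mul ((gamma_ratio p q hp hq).const_mul π)
  rw [mul_one, one_mul] at lim
  have : FF p q / GG p q = π := by
    refine tendsto_nhds_unique ?_ lim
    refine tendsto_const_nhds.congr (fun n => ?_)
    rw [← const n]
    have ha : -1 < p+q+2*(n:ℝ) := by have : (0:ℝ) ≤ n := n.cast_nonneg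
                                     linarith
    have c := cauF_zero_pos _ ha
    unfold FF GG
    have e1 : p + n + (q + n) = p + q + 2 * (n:ℝ) := by ring
    have e2 : p + n - (q + n) = b := by rw [hb]; ring
    have e3 : (p + q + 2 * (n:ℝ))/2 + 1 = (p+q)/2 + n + 1 := by ring
    rw [e1, e2, cauF_zero' _ ha, e3]
    have g0 : 0 < Real.Gamma (p+q+2*n+1) := Real.Gamma_pos_of_pos (by positivity)
    have g1 : 0 < Real.Gamma ((p+q)/2+n+1) := Real.Gamma_pos_of_pos (by positivity)
    have g2 : 0 < Real.Gamma (p+n+1) := Real.Gamma_pos_of_pos (by positivity)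
    have g3 : 0 < Real.Gamma (q+n+1) := Real.Gamma_pos_of_pos (by positivity)
    generalize Real.Gamma (p+q+2*n+1) = A at *
    generalize Real.Gamma ((p+q)/2+n+1) = B at *
    generalize Real.Gamma (p+n+1) = C at *
    generalize Real.Gamma (q+n+1) = D at *
    field_simp
  rw [div_eq_iff (Gpos p q hp hq).ne'] at this
  exact this

lemma main_real (p q : ℝ) (h : -1 < p + q) : FF p q = π * GG p q := by
  obtain ⟨n, hn⟩ := exists_nat_gt (-q)
  obtain ⟨m, hm⟩ := exists_nat_gt (-p)
  apply reduce p q h n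
  rw [FF_symm, GG_symm]
  apply reduce _ _ (by have : (0:ℝ) ≤ n := n.cast_nonneg
                       linarith) m
  exact main_pos _ _ (by linarith) (by linarith)

lemma cauF_complex (a b : ℝ) (ha : -1 < a) :
    ∫ θ in (-(π/2))..(π/2), (((2 * Real.cos θ) ^ a : ℝ) : ℂ) * Complex.exp (Complex.I * b * θ) = (cauF a b : ℂ) := by
  have i1 := cauF_int a b ha
  have i2 : IntervalIntegrable (fun θ => (2 * Real.cos θ) ^ a * Real.sin (b * θ)) MeasureTheory.volume (-(π/2)) (π/2) :=
    (cos_rpow_int a ha).mul_continuousOn (by fun_prop)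
  have odd : ∫ θ in (-(π/2))..(π/2), (2 * Real.cos θ) ^ a * Real.sin (b * θ) = 0 := by
    have := intervalIntegral.integral_comp_neg (a := -(π/2)) (b := π/2) (fun θ => (2 * Real.cos θ) ^ a * Real.sin (b * θ))
    simp only [Real.cos_neg, mul_neg, Real.sin_neg, intervalIntegral.integral_neg, neg_neg] at this
    linarith
  have e : ∀ θ : ℝ, (((2 * Real.cos θ) ^ a : ℝ) : ℂ) * Complex.exp (Complex.I * b * θ)
      = (((2 * Real.cos θ) ^ a * Real.cos (b * θ) : ℝ) : ℂ) + Complex.I * (((2 * Real.cos θ) ^ a * Real.sin (b * θ) : ℝ) : ℂ) := by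
    intro θ
    rw [show Complex.I * b * θ = ((b * θ : ℝ) : ℂ) * Complex.I by push_cast; ring, Complex.exp_mul_I]
    rw [Complex.ofReal_mul (_ ^ a), Complex.ofReal_mul (_ ^ a), Complex.ofReal_cos, Complex.ofReal_sin]
    ring
  simp_rw [e]
  have j1 : IntervalIntegrable (fun θ => (((2 * Real.cos θ) ^ a * Real.cos (b * θ) : ℝ) : ℂ))
    MeasureTheory.volume (-(π/2)) (π/2) := ⟨i1.1.ofReal, i1.2.ofReal⟩
  have j2 : IntervalIntegrable (fun θ => (((2 * Real.cos θ) ^ a * Real.sin (b * θ) : ℝ) : ℂ))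
    MeasureTheory.volume (-(π/2)) (π/2) := ⟨i2.1.ofReal, i2.2.ofReal⟩
  rw [intervalIntegral.integral_add j1 (j2.const_mul _), intervalIntegral.integral_const_mul,
    intervalIntegral.integral_ofReal, intervalIntegral.integral_ofReal, odd]
  simp [cauF]

lemma polar_cpow (r θ s : ℝ) (hr : 0 < r) (h1 : -π < θ) (h2 : θ ≤ π) :
    ((r:ℂ) * Complex.exp (θ * Complex.I)) ^ (s:ℂ) = ((r ^ s : ℝ) : ℂ) * Complex.exp (Complex.I * s * θ) := by
  rw [Complex.cpow_def_of_ne_zero (by simp [hr.ne', Complex.exp_ne_zero]),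
    Complex.log_ofReal_mul hr (Complex.exp_ne_zero _), Complex.log_exp (by simpa) (by simpa),
    Real.rpow_def_of_pos hr, Complex.ofReal_exp, ← Complex.exp_add]
  congr 1; push_cast; ring

theorem stmt10 (σ τ : ℝ) (h : -1 < σ + τ) (l : ℤ) :
    ∫ φ in (0:ℝ)..(2 * π),
        (1 - Complex.exp ((φ : ℂ) * Complex.I)) ^ (σ : ℂ)
          * (1 - Complex.exp (-(φ : ℂ) * Complex.I)) ^ (τ : ℂ)
          * Complex.exp (Complex.I * (l : ℂ) * (φ : ℂ))
      = 2 * (π : ℂ) * (-1 : ℂ) ^ l * (Real.Gamma (σ + τ + 1) : ℂ)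
          / ((Real.Gamma (τ + 1 - l) : ℂ) * (Real.Gamma (σ + 1 + l) : ℂ)) := by
  have hpi := Real.pi_pos
  have hle : -(π/2) ≤ π/2 := by linarith
  have sub := intervalIntegral.smul_integral_comp_mul_add (a := -(π/2)) (b := π/2) (fun φ : ℝ =>
    (1 - Complex.exp ((φ : ℂ) * Complex.I)) ^ (σ : ℂ)
          * (1 - Complex.exp (-(φ : ℂ) * Complex.I)) ^ (τ : ℂ)
          * Complex.exp (Complex.I * (l : ℂ) * (φ : ℂ))) 2 π
  rw [show 2 * -(π/2) + π = 0 by ring, show 2 * (π/2) + π = 2 * π by ring] at sub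
  rw [← sub]
  have key : ∫ θ in (-(π/2))..(π/2),
      (1 - Complex.exp (((2 * θ + π : ℝ) : ℂ) * Complex.I)) ^ (σ : ℂ)
          * (1 - Complex.exp (-((2 * θ + π : ℝ) : ℂ) * Complex.I)) ^ (τ : ℂ)
          * Complex.exp (Complex.I * (l : ℂ) * ((2 * θ + π : ℝ) : ℂ))
      = ∫ θ in (-(π/2))..(π/2), (-1:ℂ)^l * ((((2 * Real.cos θ) ^ (σ+τ) : ℝ) : ℂ)
          * Complex.exp (Complex.I * ((σ + l - (τ - l) : ℝ) : ℂ) * θ)) := by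
    apply intervalIntegral.integral_congr_ae
    have : ∀ᵐ x : ℝ, x ≠ π/2 := by simp [MeasureTheory.ae_iff]
    filter_upwards [this] with x hx hx'
    rw [Set.uIoc_of_le hle] at hx'
    have hc : 0 < Real.cos x := Real.cos_pos_of_mem_Ioo ⟨hx'.1, lt_of_le_of_ne hx'.2 hx⟩
    have hc2 : 0 < 2 * Real.cos x := by positivity
    have ec : ((2 * Real.cos x : ℝ) : ℂ) = Complex.exp (x * Complex.I) + Complex.exp (-x * Complex.I) := by
      push_cast
      rw [Complex.cos]; ring
    have a1 : 1 - Complex.exp (((2 * x + π : ℝ) : ℂ) * Complex.I)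
        = ((2 * Real.cos x : ℝ) : ℂ) * Complex.exp ((x:ℝ) * Complex.I) := by
      rw [ec, add_mul, ← Complex.exp_add, ← Complex.exp_add]
      push_cast
      rw [add_mul, Complex.exp_add, Complex.exp_pi_mul_I, show -(x:ℂ) * Complex.I + x * Complex.I = 0 by ring,
        Complex.exp_zero, show (x:ℂ) * Complex.I + x * Complex.I = 2 * x * Complex.I by ring]
      ring
    have a2 : 1 - Complex.exp (-((2 * x + π : ℝ) : ℂ) * Complex.I)
        = ((2 * Real.cos x : ℝ) : ℂ) * Complex.exp (((-x:ℝ):ℂ) * Complex.I) := by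
      rw [ec, add_mul, ← Complex.exp_add, ← Complex.exp_add]
      push_cast
      rw [show -(2 * (x:ℂ) + π) * Complex.I = -(2 * x * Complex.I) + -(π * Complex.I) by ring, Complex.exp_add,
        Complex.exp_neg (π * Complex.I), Complex.exp_pi_mul_I, show (x:ℂ) * Complex.I + -x * Complex.I = 0 by ring,
        Complex.exp_zero, show -(x:ℂ) * Complex.I + -x * Complex.I = -(2 * x * Complex.I) by ring]
      norm_num
    have a3 : Complex.exp (Complex.I * (l : ℂ) * ((2 * x + π : ℝ) : ℂ)) = (-1:ℂ)^l * Complex.exp (Complex.I * (2 * l) * x) := by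
      rw [← Complex.exp_pi_mul_I, ← Complex.exp_int_mul, ← Complex.exp_add]
      congr 1; push_cast; ring
    rw [a1, a2, a3, polar_cpow _ _ _ hc2 (by linarith [hx'.1]) (by linarith [hx'.2]),
      polar_cpow _ _ _ hc2 (by linarith [hx'.2]) (by linarith [hx'.1]), Real.rpow_add hc2]
    have a4 : Complex.exp (Complex.I * ((σ + l - (τ - l) : ℝ) : ℂ) * x)
      = Complex.exp (Complex.I * σ * x) * Complex.exp (Complex.I * τ * ((-x:ℝ):ℂ)) * Complex.exp (Complex.I * (2 * l) * x) := by
      rw [← Complex.exp_add, ← Complex.exp_add]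
      congr 1; push_cast; ring
    rw [a4]
    push_cast
    ring
  rw [key, intervalIntegral.integral_const_mul, cauF_complex _ _ h]
  have m := main_real (σ + l) (τ - l) (by linarith)
  unfold FF GG at m
  rw [show σ + l + (τ - l) = σ + τ by ring, show τ - l + 1 = τ + 1 - l by ring,
    show σ + l + 1 = σ + 1 + l by ring] at m
  rw [m, Complex.real_smul]
  push_cast
  ring
end

section
/- Let n ≥ 1 and let σ, τ be real numbers with σ ∉ ℤ and τ ∉ ℤ. For each nonincreasing tuple λ = (λ₁ ≥ λ₂ ≥ … ≥ λ_n) of integers, set c(λ) = ∏_{j=1}^n Γ(λ_j − τ − (j−1)) / Γ(λ_j + σ + 1 + (n−j)), where Γ is the real Gamma function; each c(λ) is nonzero under these hypotheses. Then all the numbers c(λ), as λ ranges over all nonincreasing integer tuples of length n, have the same sign if and only if ⌊−τ⌋ = ⌊σ + n⌋. -/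
/-- Real Gamma has the same sign at two non-integers in the same unit interval. -/
theorem gamma_same_sign (k : ℕ) : ∀ x y : ℝ, -(k : ℝ) < x → (∀ m : ℤ, x ≠ m) →
    (∀ m : ℤ, y ≠ m) → ⌊x⌋ = ⌊y⌋ → 0 < Real.Gamma x / Real.Gamma y := by
  induction k with
  | zero =>
    intro x y hx hxm hym h
    have hx0 : 0 < x := by simpa using hx
    have h0 : (0 : ℤ) ≤ ⌊y⌋ := h ▸ Int.floor_nonneg.mpr hx0.le
    have hy : 0 < y := lt_of_le_of_ne (Int.floor_nonneg.mp h0) (by simpa using (hym 0).symm)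
    exact div_pos (Real.Gamma_pos_of_pos hx0) (Real.Gamma_pos_of_pos hy)
  | succ k ih =>
    intro x y hx hxm hym h
    have hx0 : x ≠ 0 := by simpa using hxm 0
    have hy0 : y ≠ 0 := by simpa using hym 0
    have key := ih (x + 1) (y + 1) (by push_cast at hx; linarith)
      (fun m hm => hxm (m - 1) (by push_cast; linarith))
      (fun m hm => hym (m - 1) (by push_cast; linarith))
      (by rw [Int.floor_add_one, Int.floor_add_one, h])
    rw [Real.Gamma_add_one hx0, Real.Gamma_add_one hy0, mul_div_mul_comm] at key
    have hxy : 0 < x / y := by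
      rcases lt_or_gt_of_ne hx0 with hx1 | hx1
      · have h1 : ⌊y⌋ < 0 := h ▸ Int.floor_lt.mpr (by simpa using hx1)
        have hy1 : y < 0 := by simpa using Int.floor_lt.mp h1
        exact div_pos_of_neg_of_neg hx1 hy1
      · have h1 : (0 : ℤ) ≤ ⌊y⌋ := h ▸ Int.floor_nonneg.mpr hx1.le
        exact div_pos hx1 (lt_of_le_of_ne (Int.floor_nonneg.mp h1) hy0.symm)
    exact (mul_pos_iff_of_pos_left hxy).mp key

theorem gamma_neg_unit {x : ℝ} (h1 : -1 < x) (h0 : x < 0) : Real.Gamma x < 0 := by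
  have h := Real.Gamma_pos_of_pos (show 0 < x + 1 by linarith)
  rw [Real.Gamma_add_one h0.ne] at h
  exact neg_of_mul_pos_right h h0.le

/-- Positivity criterion for the Stein–Sahi form on `U(n)` (the case `κ = 1`):
the eigenvalue factors `c(λ) = ∏ⱼ Γ(λⱼ − τ − (j−1))/Γ(λⱼ + σ + 1 + (n−j))` are all
nonzero, and they all have the same sign for all nonincreasing integer tuples `λ`
iff `⌊−τ⌋ = ⌊σ + n⌋`. -/
theorem stmt12 (n : ℕ) (hn : 1 ≤ n) (σ τ : ℝ)
    (hσ : ∀ m : ℤ, σ ≠ (m : ℝ)) (hτ : ∀ m : ℤ, τ ≠ (m : ℝ)) :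
    (∀ lam : Fin n → ℤ, Antitone lam →
        (∏ j : Fin n, Real.Gamma ((lam j : ℝ) - τ - ((j : ℕ) : ℝ))
          / Real.Gamma ((lam j : ℝ) + σ + 1 + ((n : ℝ) - 1 - ((j : ℕ) : ℝ)))) ≠ 0)
    ∧ (((∀ lam : Fin n → ℤ, Antitone lam →
            0 < ∏ j : Fin n, Real.Gamma ((lam j : ℝ) - τ - ((j : ℕ) : ℝ))
              / Real.Gamma ((lam j : ℝ) + σ + 1 + ((n : ℝ) - 1 - ((j : ℕ) : ℝ))))
          ∨ (∀ lam : Fin n → ℤ, Antitone lam →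
            (∏ j : Fin n, Real.Gamma ((lam j : ℝ) - τ - ((j : ℕ) : ℝ))
              / Real.Gamma ((lam j : ℝ) + σ + 1 + ((n : ℝ) - 1 - ((j : ℕ) : ℝ)))) < 0))
        ↔ ⌊-τ⌋ = ⌊σ + (n : ℝ)⌋) := by
  have hA : ∀ m p : ℤ, (m : ℝ) - τ ≠ p := fun m p h => hτ (m - p) (by push_cast; linarith)
  have hB : ∀ m p : ℤ, (m : ℝ) + (σ + n) ≠ p := fun m p h =>
    hσ (p - m - n) (by push_cast; linarith)
  have gne : ∀ x : ℝ, (∀ p : ℤ, x ≠ p) → Real.Gamma x ≠ 0 := fun x hx =>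
    Real.Gamma_ne_zero (fun m h => hx (-m) (by push_cast; exact h))
  obtain ⟨f, hf⟩ : ∃ f : ℤ → ℝ, ∀ m, f m = Real.Gamma (m - τ) / Real.Gamma (m + (σ + n)) :=
    ⟨_, fun _ => rfl⟩
  have hterm : ∀ (lam : Fin n → ℤ) (j : Fin n), Real.Gamma ((lam j : ℝ) - τ - ((j : ℕ) : ℝ))
          / Real.Gamma ((lam j : ℝ) + σ + 1 + ((n : ℝ) - 1 - ((j : ℕ) : ℝ)))
          = f (lam j - (j : ℕ)) := by
    intro lam j
    rw [hf]
    push_cast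
    congr 2 <;> ring
  simp only [hterm]
  have fne : ∀ m, f m ≠ 0 := fun m => by
    rw [hf]; exact div_ne_zero (gne _ (hA m)) (gne _ (hB m))
  refine ⟨fun lam _ => Finset.prod_ne_zero_iff.mpr fun j _ => fne _, ?_, ?_⟩
  · intro h
    by_contra hab
    -- positivity for large arguments
    obtain ⟨M, hM⟩ : ∃ M : ℤ, ∀ m, M ≤ m → 0 < f m := by
      refine ⟨max (⌈τ⌉ + 1) (⌈-(σ + n)⌉ + 1), fun m hm => ?_⟩
      have h1 : ((⌈τ⌉ + 1 : ℤ) : ℝ) ≤ m := by exact_mod_cast (le_max_left _ _).trans hm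
      have h2 : ((⌈-(σ + n)⌉ + 1 : ℤ) : ℝ) ≤ m := by exact_mod_cast (le_max_right _ _).trans hm
      push_cast at h1 h2
      have h3 := Int.le_ceil τ
      have h4 := Int.le_ceil (-(σ + n))
      rw [hf]
      exact div_pos (Real.Gamma_pos_of_pos (by linarith)) (Real.Gamma_pos_of_pos (by linarith))
    -- a negative value
    obtain ⟨m0, hm0⟩ : ∃ m0, f m0 < 0 := by
      have a1 := Int.floor_le (-τ)
      have a2 := Int.lt_floor_add_one (-τ)
      have b1 := Int.floor_le (σ + n)
      have b2 := Int.lt_floor_add_one (σ + n)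
      have a3 : (⌊-τ⌋ : ℝ) ≠ -τ := fun h => hτ (-⌊-τ⌋) (by push_cast; linarith)
      have b3 : (⌊σ + n⌋ : ℝ) ≠ σ + n := fun h => hσ (⌊σ + n⌋ - n) (by push_cast; linarith)
      have a4 := lt_of_le_of_ne a1 a3
      have b4 := lt_of_le_of_ne b1 b3
      rcases lt_or_gt_of_ne hab with hl | hl
      · have hl' : (⌊-τ⌋ : ℝ) + 1 ≤ ⌊σ + n⌋ := by exact_mod_cast hl
        refine ⟨-⌊-τ⌋ - 1, ?_⟩
        rw [hf]; push_cast
        exact div_neg_of_neg_of_pos (gamma_neg_unit (by linarith) (by linarith))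
          (Real.Gamma_pos_of_pos (by linarith))
      · have hl' : (⌊σ + n⌋ : ℝ) + 1 ≤ ⌊-τ⌋ := by exact_mod_cast hl
        refine ⟨-⌊σ + n⌋ - 1, ?_⟩
        rw [hf]; push_cast
        exact div_neg_of_pos_of_neg (Real.Gamma_pos_of_pos (by linarith))
          (gamma_neg_unit (by linarith) (by linarith))
    have hlt : m0 < M := by
      by_contra hc
      exact absurd (hM m0 (not_lt.mp hc)) (not_lt.mpr hm0.le)
    rcases h with h | h
    · let e : Fin n := ⟨n - 1, by omega⟩
      have h1 := h (fun j => if j = e then m0 + (n - 1 : ℕ) else M + (n - 1 : ℕ)) (by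
        intro i j hij
        have hj : (j : ℕ) ≤ n - 1 := by omega
        have hij' : (i : ℕ) ≤ j := hij
        by_cases h1 : i = e
        · have h2 : j = e := Fin.ext (by rw [h1] at hij'; simp only [e] at hij' ⊢; omega)
          simp [h1, h2]
        · simp only [h1, if_false]
          split_ifs <;> omega)
      rw [← Finset.mul_prod_erase _ _ (Finset.mem_univ e)] at h1
      have h2 : f ((if e = e then m0 + (n - 1 : ℕ) else M + (n - 1 : ℕ)) - (e : ℕ)) < 0 := by
        simpa [e] using hm0
      refine absurd h1 (not_lt.mpr (mul_neg_of_neg_of_pos h2 (Finset.prod_pos ?_)).le)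
      intro j hj
      apply hM
      rw [if_neg (Finset.ne_of_mem_erase hj)]
      omega
    · have h1 := h (fun _ => M + n) (fun _ _ _ => le_rfl)
      refine absurd h1 (not_lt.mpr (Finset.prod_pos fun j _ => hM _ ?_).le)
      have := j.2
      omega
  · intro hab
    left
    intro lam _
    refine Finset.prod_pos fun j _ => ?_
    rw [hf]
    generalize lam j - ((j : ℕ) : ℤ) = m
    obtain ⟨k, hk⟩ := exists_nat_gt (-((m : ℝ) - τ))
    refine gamma_same_sign k _ _ (by linarith) (hA m) (hB m) ?_
    rw [sub_eq_add_neg, Int.floor_intCast_add, Int.floor_intCast_add, hab]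
end

section
/- Let n > 1 and let σ, τ be real numbers with σ ∉ ℤ and τ ∉ ℤ. For each nonincreasing tuple λ = (λ₁ ≥ λ₂ ≥ … ≥ λ_n) of integers, set c(λ) = ∏_{j=1}^n Γ(λ_j − τ − 2(j−1)) / Γ(λ_j + σ + 1 + 2(n−j)), where Γ is the real Gamma function; each c(λ) is nonzero under these hypotheses. Then all the numbers c(λ), as λ ranges over all nonincreasing integer tuples of length n, have the same sign if and only if ⌊−τ⌋ = ⌊σ + 2n − 1⌋. -/
theorem aux_same (k : ℕ) : ∀ x y : ℝ, (∀ m : ℤ, x ≠ m) → (∀ m : ℤ, y ≠ m) → ⌊x⌋ = ⌊y⌋ →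
    -(k : ℤ) ≤ ⌊x⌋ → 0 < Real.Gamma x / Real.Gamma y := by
  induction k with
  | zero =>
    intro x y hx hy h hk
    have h0 : (0 : ℤ) ≤ ⌊x⌋ := by simpa using hk
    have h1 : (0 : ℝ) ≤ x := Int.floor_nonneg.mp h0
    have h2 : (0 : ℝ) ≤ y := Int.floor_nonneg.mp (h ▸ h0)
    have h3 : x ≠ 0 := by simpa using hx 0
    have h4 : y ≠ 0 := by simpa using hy 0
    exact div_pos (Real.Gamma_pos_of_pos (lt_of_le_of_ne h1 h3.symm))
      (Real.Gamma_pos_of_pos (lt_of_le_of_ne h2 h4.symm))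
  | succ k ih =>
    intro x y hx hy h hk
    by_cases hc : -(k : ℤ) ≤ ⌊x⌋
    · exact ih x y hx hy h hc
    have hneg : ⌊x⌋ < 0 := by omega
    have hx0 : x < 0 := Int.floor_lt_zero.mp hneg
    have hy0 : y < 0 := Int.floor_lt_zero.mp (h ▸ hneg)
    have key := ih (x + 1) (y + 1)
      (fun m hm => hx (m - 1) (by push_cast; linarith))
      (fun m hm => hy (m - 1) (by push_cast; linarith))
      (by rw [Int.floor_add_one, Int.floor_add_one, h])
      (by rw [Int.floor_add_one]; push_cast at hk; omega)
    rw [Real.Gamma_add_one hx0.ne, Real.Gamma_add_one hy0.ne, mul_div_mul_comm] at key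
    exact (pos_iff_pos_of_mul_pos key).mp (div_pos_of_neg_of_neg hx0 hy0)

theorem aux_neg (x : ℝ) (h1 : -1 < x) (h2 : x < 0) : Real.Gamma x < 0 := by
  have h : 0 < Real.Gamma (x + 1) := Real.Gamma_pos_of_pos (by linarith)
  rw [Real.Gamma_add_one h2.ne] at h
  exact neg_of_mul_pos_right h h2.le

/-- Positivity criterion for the Stein–Sahi form on `U(2n)/Sp(n)` (the case `κ = 2`):
the eigenvalue factors `c(λ) = ∏ⱼ Γ(λⱼ − τ − 2(j−1))/Γ(λⱼ + σ + 1 + 2(n−j))` are all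
nonzero, and they all have the same sign for all nonincreasing integer tuples `λ`
iff `⌊−τ⌋ = ⌊σ + 2n − 1⌋`. -/
theorem stmt13 (n : ℕ) (hn : 1 < n) (σ τ : ℝ)
    (hσ : ∀ m : ℤ, σ ≠ (m : ℝ)) (hτ : ∀ m : ℤ, τ ≠ (m : ℝ)) :
    (∀ lam : Fin n → ℤ, Antitone lam →
        (∏ j : Fin n, Real.Gamma ((lam j : ℝ) - τ - 2 * ((j : ℕ) : ℝ))
          / Real.Gamma ((lam j : ℝ) + σ + 1 + 2 * ((n : ℝ) - 1 - ((j : ℕ) : ℝ)))) ≠ 0)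
    ∧ (((∀ lam : Fin n → ℤ, Antitone lam →
            0 < ∏ j : Fin n, Real.Gamma ((lam j : ℝ) - τ - 2 * ((j : ℕ) : ℝ))
              / Real.Gamma ((lam j : ℝ) + σ + 1 + 2 * ((n : ℝ) - 1 - ((j : ℕ) : ℝ))))
          ∨ (∀ lam : Fin n → ℤ, Antitone lam →
            (∏ j : Fin n, Real.Gamma ((lam j : ℝ) - τ - 2 * ((j : ℕ) : ℝ))
              / Real.Gamma ((lam j : ℝ) + σ + 1 + 2 * ((n : ℝ) - 1 - ((j : ℕ) : ℝ)))) < 0))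
        ↔ ⌊-τ⌋ = ⌊σ + 2 * (n : ℝ) - 1⌋) := by
  have nx : ∀ (l : ℤ) (j : ℕ) (m : ℤ), (l : ℝ) - τ - 2 * (j : ℝ) ≠ m := by
    intro l j m h
    exact hτ (l - 2 * j - m) (by push_cast; linarith)
  have ny : ∀ (l : ℤ) (j : ℕ) (m : ℤ),
      (l : ℝ) + σ + 1 + 2 * ((n : ℝ) - 1 - (j : ℝ)) ≠ m := by
    intro l j m h
    exact hσ (m - l - 1 - 2 * (n - 1 - j)) (by push_cast; linarith)
  have gne : ∀ x : ℝ, (∀ m : ℤ, x ≠ m) → Real.Gamma x ≠ 0 := by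
    intro x hx
    refine Real.Gamma_ne_zero fun m h => hx (-m) (by push_cast; exact h)
  refine ⟨?_, ?_, ?_⟩
  · intro lam _
    exact Finset.prod_ne_zero_iff.mpr fun j _ =>
      div_ne_zero (gne _ (nx _ _)) (gne _ (ny _ _))
  · intro hs
    by_contra hab
    set a := ⌊-τ⌋ with ha
    set b := ⌊σ + 2 * (n : ℝ) - 1⌋ with hb
    have a1 : (a : ℝ) < -τ := lt_of_le_of_ne (Int.floor_le _)
      (fun h => hτ (-a) (by push_cast; linarith))
    have a2 : -τ < a + 1 := Int.lt_floor_add_one _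
    have b1 : (b : ℝ) < σ + 2 * (n : ℝ) - 1 := lt_of_le_of_ne (Int.floor_le _)
      (fun h => hσ (b - 2 * n + 1) (by push_cast; linarith))
    have b2 : σ + 2 * (n : ℝ) - 1 < b + 1 := Int.lt_floor_add_one _
    obtain ⟨A, hA⟩ : ∃ A, A = min a b := ⟨_, rfl⟩
    have hAa : (A : ℝ) ≤ a := by exact_mod_cast hA ▸ min_le_left a b
    have hAb : (A : ℝ) ≤ b := by exact_mod_cast hA ▸ min_le_right a b
    have hjn : ∀ j : Fin n, ((j : ℕ) : ℝ) + 1 ≤ n := fun j => by exact_mod_cast j.2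
    have fpos : ∀ j : Fin n, 0 < Real.Gamma (((2 * n - A : ℤ) : ℝ) - τ - 2 * ((j : ℕ) : ℝ))
        / Real.Gamma (((2 * n - A : ℤ) : ℝ) + σ + 1 + 2 * ((n : ℝ) - 1 - ((j : ℕ) : ℝ))) := by
      intro j
      have := hjn j
      apply div_pos <;> apply Real.Gamma_pos_of_pos <;> push_cast <;> linarith
    have h1 := Finset.prod_pos (s := Finset.univ) fun j _ => fpos j
    let lam : Fin n → ℤ := fun j => if (j : ℕ) + 1 = n then 2 * n - A - 3 else 2 * n - A
    have hlam : Antitone lam := by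
      intro i j hij
      have hij' : (i : ℕ) ≤ j := hij
      have := j.2
      simp only [lam]
      split_ifs <;> omega
    have h2 : (∏ j : Fin n, Real.Gamma ((lam j : ℝ) - τ - 2 * ((j : ℕ) : ℝ))
          / Real.Gamma ((lam j : ℝ) + σ + 1 + 2 * ((n : ℝ) - 1 - ((j : ℕ) : ℝ)))) < 0 := by
      let l : Fin n := ⟨n - 1, by omega⟩
      rw [← Finset.mul_prod_erase _ _ (Finset.mem_univ l)]
      apply mul_neg_of_neg_of_pos
      · have hl : lam l = 2 * n - A - 3 := by simp only [lam, l]; rw [if_pos (by omega)]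
        have hl2 : ((l : ℕ) : ℝ) = n - 1 := by
          simp only [l]; rw [Nat.cast_sub (by omega)]; simp
        rw [hl, hl2]
        push_cast
        rcases lt_or_gt_of_ne hab with h | h
        · have hA' : A = a := by rw [hA]; exact min_eq_left h.le
          have h' : (a : ℝ) + 1 ≤ b := by exact_mod_cast h
          rw [hA']
          apply div_neg_of_neg_of_pos
          · apply aux_neg <;> linarith
          · apply Real.Gamma_pos_of_pos; linarith
        · have hA' : A = b := by rw [hA]; exact min_eq_right h.le
          have h' : (b : ℝ) + 1 ≤ a := by exact_mod_cast h
          rw [hA']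
          apply div_neg_of_pos_of_neg
          · apply Real.Gamma_pos_of_pos; linarith
          · apply aux_neg <;> linarith
      · apply Finset.prod_pos
        intro j hj
        have hne : j ≠ l := Finset.ne_of_mem_erase hj
        have hl : lam j = 2 * n - A := by
          simp only [lam]
          rw [if_neg]
          intro h
          apply hne
          ext
          simp only [l]
          omega
        rw [hl]
        exact fpos j
    rcases hs with hs | hs
    · exact absurd (hs lam hlam) (not_lt.mpr h2.le)
    · exact absurd (hs (fun _ => 2 * n - A) antitone_const) (not_lt.mpr h1.le)
  · intro hab
    left
    intro lam _
    apply Finset.prod_pos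
    intro j _
    have e1 : (lam j : ℝ) - τ - 2 * ((j : ℕ) : ℝ) = -τ + ((lam j - 2 * (j : ℕ) : ℤ) : ℝ) := by
      push_cast; ring
    have e2 : (lam j : ℝ) + σ + 1 + 2 * ((n : ℝ) - 1 - ((j : ℕ) : ℝ))
        = σ + 2 * (n : ℝ) - 1 + ((lam j - 2 * (j : ℕ) : ℤ) : ℝ) := by
      push_cast; ring
    refine aux_same (⌊(lam j : ℝ) - τ - 2 * ((j : ℕ) : ℝ)⌋.natAbs) _ _ (nx _ _) (ny _ _) ?_ ?_
    · rw [e1, e2, Int.floor_add_intCast, Int.floor_add_intCast, hab]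
    · omega
end

section
/- Let n > 1 and let σ, τ be real numbers with 2σ ∉ ℤ and 2τ ∉ ℤ. For each nonincreasing tuple λ = (λ₁ ≥ λ₂ ≥ … ≥ λ_n) of integers, set c(λ) = ∏_{j=1}^n Γ(λ_j − τ − (j−1)/2) / Γ(λ_j + σ + 1 + (n−j)/2), where Γ is the real Gamma function; each c(λ) is nonzero under these hypotheses. Then all the numbers c(λ), as λ ranges over all nonincreasing integer tuples of length n, have the same sign if and only if ⌊−2τ − n − 1⌋ = ⌊2σ⌋. -/
/-- The factor of `c(λ)` with index `j` and entry `m`. -/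
noncomputable def facF (n : ℕ) (σ τ : ℝ) (j : ℕ) (m : ℤ) : ℝ :=
  Real.Gamma ((m : ℝ) - τ - (j : ℝ) / 2)
    / Real.Gamma ((m : ℝ) + σ + 1 + ((n : ℝ) - 1 - (j : ℝ)) / 2)

lemma facF_ne (n : ℕ) (σ τ : ℝ)
    (hσ : ∀ m : ℤ, 2 * σ ≠ (m : ℝ)) (hτ : ∀ m : ℤ, 2 * τ ≠ (m : ℝ)) (j : ℕ) (m : ℤ) :
    facF n σ τ j m ≠ 0 := by
  unfold facF
  apply div_ne_zero
  · apply Real.Gamma_ne_zero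
    intro k hk
    apply hτ (2 * m - j + 2 * k)
    push_cast
    linarith
  · apply Real.Gamma_ne_zero
    intro k hk
    apply hσ (-2 * m - 2 - (n - 1 - j) - 2 * k)
    push_cast
    linarith

lemma facF_step (n : ℕ) (σ τ : ℝ)
    (hσ : ∀ m : ℤ, 2 * σ ≠ (m : ℝ)) (hτ : ∀ m : ℤ, 2 * τ ≠ (m : ℝ)) (j : ℕ) (m : ℤ) :
    0 < facF n σ τ j m * facF n σ τ j (m + 1) ↔
      (-(2 * m - j) - n - 1 ≤ ⌊-2 * τ - (n : ℝ) - 1⌋ ↔ -(2 * m - j) - n - 1 ≤ ⌊2 * σ⌋) := by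
  have h0 := facF_ne n σ τ hσ hτ j m
  have hA : (m : ℝ) - τ - (j : ℝ) / 2 ≠ 0 := by
    intro h
    apply hτ (2 * m - j)
    push_cast
    linarith
  have hB : (m : ℝ) + σ + 1 + ((n : ℝ) - 1 - (j : ℝ)) / 2 ≠ 0 := by
    intro h
    apply hσ (-2 * m - 2 - (n - 1 - j))
    push_cast
    linarith
  have hs : facF n σ τ j (m + 1) = facF n σ τ j m *
      (((m : ℝ) - τ - (j : ℝ) / 2) / ((m : ℝ) + σ + 1 + ((n : ℝ) - 1 - (j : ℝ)) / 2)) := by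
    unfold facF
    have e1 : ((m + 1 : ℤ) : ℝ) - τ - (j : ℝ) / 2 = ((m : ℝ) - τ - (j : ℝ) / 2) + 1 := by
      push_cast; ring
    have e2 : ((m + 1 : ℤ) : ℝ) + σ + 1 + ((n : ℝ) - 1 - (j : ℝ)) / 2
        = ((m : ℝ) + σ + 1 + ((n : ℝ) - 1 - (j : ℝ)) / 2) + 1 := by
      push_cast; ring
    rw [e1, e2, Real.Gamma_add_one hA, Real.Gamma_add_one hB, mul_div_mul_comm, mul_comm]
  rw [hs, ← mul_assoc, mul_pos_iff_of_pos_left (mul_self_pos.mpr h0), div_pos_iff, Int.le_floor,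
    Int.le_floor]
  have c1 : (((-(2 * m - j) - n - 1 : ℤ) : ℝ) ≤ -2 * τ - (n : ℝ) - 1) ↔
      0 < (m : ℝ) - τ - (j : ℝ) / 2 := by
    push_cast
    constructor
    · intro h
      exact lt_of_le_of_ne (by linarith) hA.symm
    · intro h
      linarith
  have c2 : (((-(2 * m - j) - n - 1 : ℤ) : ℝ) ≤ 2 * σ) ↔
      0 < (m : ℝ) + σ + 1 + ((n : ℝ) - 1 - (j : ℝ)) / 2 := by
    push_cast
    constructor
    · intro h
      exact lt_of_le_of_ne (by linarith) hB.symm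
    · intro h
      linarith
  rw [c1, c2]
  rcases lt_or_gt_of_ne hA with ha | ha <;> rcases lt_or_gt_of_ne hB with hb | hb <;>
    simp [ha, hb, ha.le, hb.le, not_lt.mpr]

lemma facF_const (n : ℕ) (σ τ : ℝ)
    (hσ : ∀ m : ℤ, 2 * σ ≠ (m : ℝ)) (hτ : ∀ m : ℤ, 2 * τ ≠ (m : ℝ))
    (h : ⌊-2 * τ - (n : ℝ) - 1⌋ = ⌊2 * σ⌋) (j : ℕ) (m : ℤ) :
    0 < facF n σ τ j m * facF n σ τ j 0 := by
  have hstep : ∀ m : ℤ, 0 < facF n σ τ j m * facF n σ τ j (m + 1) := fun m =>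
    (facF_step n σ τ hσ hτ j m).mpr (by rw [h])
  have key : ∀ a b c : ℝ, 0 < a * b → 0 < b * c → 0 < a * c := by
    intro a b c h1 h2
    by_contra hc
    have hb : 0 < b * b := mul_self_pos.mpr (by rintro rfl; simp at h1)
    nlinarith [mul_pos h1 h2]
  induction m using Int.induction_on with
  | zero => exact mul_self_pos.mpr (facF_ne n σ τ hσ hτ j 0)
  | succ i ih => exact key _ _ _ (by rw [mul_comm]; exact hstep i) ih
  | pred i ih =>
    refine key _ _ _ ?_ ih
    have := hstep (-(i : ℤ) - 1)
    simpa using this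


/-- Positivity criterion for the Stein–Sahi form on `U(n)/O(n)` (the case `κ = 1/2`):
the eigenvalue factors `c(λ) = ∏ⱼ Γ(λⱼ − τ − (j−1)/2)/Γ(λⱼ + σ + 1 + (n−j)/2)` are all
nonzero, and they all have the same sign for all nonincreasing integer tuples `λ`
iff `⌊−2τ − n − 1⌋ = ⌊2σ⌋`. -/
theorem stmt14 (n : ℕ) (hn : 1 < n) (σ τ : ℝ)
    (hσ : ∀ m : ℤ, 2 * σ ≠ (m : ℝ)) (hτ : ∀ m : ℤ, 2 * τ ≠ (m : ℝ)) :
    (∀ lam : Fin n → ℤ, Antitone lam →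
        (∏ j : Fin n, Real.Gamma ((lam j : ℝ) - τ - ((j : ℕ) : ℝ) / 2)
          / Real.Gamma ((lam j : ℝ) + σ + 1 + ((n : ℝ) - 1 - ((j : ℕ) : ℝ)) / 2)) ≠ 0)
    ∧ (((∀ lam : Fin n → ℤ, Antitone lam →
            0 < ∏ j : Fin n, Real.Gamma ((lam j : ℝ) - τ - ((j : ℕ) : ℝ) / 2)
              / Real.Gamma ((lam j : ℝ) + σ + 1 + ((n : ℝ) - 1 - ((j : ℕ) : ℝ)) / 2))
          ∨ (∀ lam : Fin n → ℤ, Antitone lam →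
            (∏ j : Fin n, Real.Gamma ((lam j : ℝ) - τ - ((j : ℕ) : ℝ) / 2)
              / Real.Gamma ((lam j : ℝ) + σ + 1 + ((n : ℝ) - 1 - ((j : ℕ) : ℝ)) / 2)) < 0))
        ↔ ⌊-2 * τ - (n : ℝ) - 1⌋ = ⌊2 * σ⌋) := by
  have hne : ∀ lam : Fin n → ℤ, (∏ j : Fin n, facF n σ τ j (lam j)) ≠ 0 := fun lam =>
    Finset.prod_ne_zero_iff.mpr fun j _ => facF_ne n σ τ hσ hτ j (lam j)
  refine ⟨fun lam _ => hne lam, ?_⟩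
  change ((∀ lam : Fin n → ℤ, Antitone lam → 0 < ∏ j : Fin n, facF n σ τ j (lam j)) ∨
    (∀ lam : Fin n → ℤ, Antitone lam → (∏ j : Fin n, facF n σ τ j (lam j)) < 0)) ↔ _
  constructor
  · intro h
    have hpos : ∀ l l' : Fin n → ℤ, Antitone l → Antitone l' →
        0 < (∏ j : Fin n, facF n σ τ j (l j)) * ∏ j : Fin n, facF n σ τ j (l' j) := by
      intro l l' hl hl'
      rcases h with h | h
      · exact mul_pos (h l hl) (h l' hl')
      · exact mul_pos_of_neg_of_neg (h l hl) (h l' hl')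
    have hmain : ∀ (s : ℕ) (_ : s < n) (m : ℤ),
        0 < facF n σ τ s m * facF n σ τ s (m + 1) := by
      intro s hs m
      have hanti : ∀ t : ℕ, Antitone (fun i : Fin n => if (i : ℕ) < t then m + 1 else m) := by
        intro t i i' hii
        have : (i : ℕ) ≤ i' := hii
        dsimp only
        split_ifs <;> omega
      have h1 := hpos _ _ (hanti s) (hanti (s + 1))
      rw [← Finset.mul_prod_erase Finset.univ _ (Finset.mem_univ (⟨s, hs⟩ : Fin n)),
        ← Finset.mul_prod_erase Finset.univ (fun j : Fin n => facF n σ τ j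
          (if (j : ℕ) < s + 1 then m + 1 else m)) (Finset.mem_univ (⟨s, hs⟩ : Fin n))] at h1
      have e : ∏ x ∈ Finset.univ.erase (⟨s, hs⟩ : Fin n), facF n σ τ x
            (if (x : ℕ) < s + 1 then m + 1 else m)
          = ∏ x ∈ Finset.univ.erase (⟨s, hs⟩ : Fin n), facF n σ τ x
            (if (x : ℕ) < s then m + 1 else m) := by
        apply Finset.prod_congr rfl
        intro x hx
        have hxs : (x : ℕ) ≠ s := fun hh => Finset.ne_of_mem_erase hx (Fin.ext hh)
        have : ((x : ℕ) < s + 1) ↔ (x : ℕ) < s := by omega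
        simp only [this]
      rw [e] at h1
      simp only [lt_irrefl, if_false, Nat.lt_succ_self, if_true] at h1
      rw [mul_mul_mul_comm] at h1
      exact pos_of_mul_pos_left h1 (mul_self_nonneg _)
    have hall : ∀ k : ℤ, k ≤ ⌊-2 * τ - (n : ℝ) - 1⌋ ↔ k ≤ ⌊2 * σ⌋ := by
      intro k
      obtain ⟨s, m, hs, hk⟩ : ∃ (s : ℕ) (m : ℤ), s < n ∧ k = -(2 * m - s) - n - 1 := by
        rcases Int.even_or_odd' (-k - n - 1) with ⟨c, hc | hc⟩
        · exact ⟨0, c, by omega, by push_cast; omega⟩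
        · exact ⟨1, c + 1, by omega, by push_cast; omega⟩
      rw [hk]
      exact (facF_step n σ τ hσ hτ s m).mp (hmain s hs m)
    exact le_antisymm ((hall _).mp le_rfl) ((hall _).mpr le_rfl)
  · intro h
    have hc : ∀ lam : Fin n → ℤ, 0 < (∏ j : Fin n, facF n σ τ j (lam j)) *
        ∏ j : Fin n, facF n σ τ j 0 := by
      intro lam
      rw [← Finset.prod_mul_distrib]
      exact Finset.prod_pos fun j _ => facF_const n σ τ hσ hτ h j (lam j)
    rcases lt_or_gt_of_ne (hne fun _ => 0) with h0 | h0
    · exact Or.inr fun lam _ => neg_of_mul_pos_left (hc lam) h0.le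
    · exact Or.inl fun lam _ => pos_of_mul_pos_left (hc lam) h0.le
end

section
/- Let n ≥ 1, let z be an n×n complex matrix that is unitary (z⋆z = 1) and symmetric (z = zᵗ), and let g = [[Φ,Ψ],[conj(Ψ),conj(Φ)]] be an (n+n)×(n+n) complex block matrix (with n×n blocks) satisfying g⋆ · diag(1ₙ, −1ₙ) · g = diag(1ₙ, −1ₙ) and gᵗ · [[0,1ₙ],[−1ₙ,0]] · g = [[0,1ₙ],[−1ₙ,0]]. Then Φ + z·conj(Ψ) is invertible and the matrix (Φ + z·conj(Ψ))⁻¹ · (Ψ + z·conj(Φ)) is unitary and symmetric. -/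
open Matrix

open scoped ComplexOrder in
theorem stmt15_aux (n : ℕ) (z Φ Ψ P Q : Matrix (Fin n) (Fin n) ℂ)
    (hzu : zᴴ * z = 1) (hzs : zᵀ = z)
    (hg1 : (fromBlocks Φ Ψ P Q)ᴴ * fromBlocks 1 0 0 (-1) * fromBlocks Φ Ψ P Q
        = fromBlocks (1 : Matrix (Fin n) (Fin n) ℂ) 0 0 (-1))
    (hg2 : (fromBlocks Φ Ψ P Q)ᵀ * fromBlocks 0 1 (-1) 0 * fromBlocks Φ Ψ P Q
        = fromBlocks 0 (1 : Matrix (Fin n) (Fin n) ℂ) (-1) 0) :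
    IsUnit (Φ + z * P)
    ∧ ((Φ + z * P)⁻¹ * (Ψ + z * Q))ᴴ * ((Φ + z * P)⁻¹ * (Ψ + z * Q)) = 1
    ∧ ((Φ + z * P)⁻¹ * (Ψ + z * Q))ᵀ = (Φ + z * P)⁻¹ * (Ψ + z * Q) := by
  have hz' : z * zᴴ = 1 := mul_eq_one_comm.mp hzu
  have h1 : fromBlocks Φ Ψ P Q * fromBlocks Φᴴ (-Pᴴ) (-Ψᴴ) Qᴴ = 1 := by
    rw [mul_eq_one_comm]
    have := congrArg (fun M => fromBlocks (1 : Matrix (Fin n) (Fin n) ℂ) 0 0 (-1) * M) hg1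
    simpa [fromBlocks_multiply, fromBlocks_conjTranspose, ← mul_assoc, fromBlocks_one, add_comm] using this
  have h2 : fromBlocks Φ Ψ P Q * fromBlocks Qᵀ (-Ψᵀ) (-Pᵀ) Φᵀ = 1 := by
    rw [mul_eq_one_comm]
    have := congrArg (fun M => fromBlocks (0 : Matrix (Fin n) (Fin n) ℂ) (-1) 1 0 * M) hg2
    simpa [fromBlocks_multiply, fromBlocks_transpose, ← mul_assoc, fromBlocks_one, add_comm] using this
  rw [fromBlocks_multiply, ← fromBlocks_one, fromBlocks_inj] at h1 h2
  obtain ⟨a1, a2, a3, a4⟩ := h1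
  obtain ⟨b1, b2, b3, b4⟩ := h2
  have hA : (Φ + z * P) * (Φ + z * P)ᴴ = (Ψ + z * Q) * (Ψ + z * Q)ᴴ := by
    rw [← sub_eq_zero]
    have e : (Φ + z * P) * (Φ + z * P)ᴴ - (Ψ + z * Q) * (Ψ + z * Q)ᴴ
        = (Φ * Φᴴ + Ψ * -Ψᴴ) - (Φ * -Pᴴ + Ψ * Qᴴ) * zᴴ + z * (P * Φᴴ + Q * -Ψᴴ)
          - z * (P * -Pᴴ + Q * Qᴴ) * zᴴ := by
      simp only [conjTranspose_add, conjTranspose_mul]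
      noncomm_ring
    rw [e, a1, a2, a3, a4]
    simp [hz']
  have hB : (Φ + z * P) * (Ψ + z * Q)ᵀ = (Ψ + z * Q) * (Φ + z * P)ᵀ := by
    rw [← sub_eq_zero]
    have e : (Φ + z * P) * (Ψ + z * Q)ᵀ - (Ψ + z * Q) * (Φ + z * P)ᵀ
        = -(Φ * -Ψᵀ + Ψ * Φᵀ) + (Φ * Qᵀ + Ψ * -Pᵀ) * z + z * (P * Qᵀ + Q * -Pᵀ) * z
          - z * (P * -Ψᵀ + Q * Φᵀ) := by
      simp only [transpose_add, transpose_mul, hzs]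
      noncomm_ring
    rw [e, b1, b2, b3, b4]
    simp
  have hC : (Φ + z * P) * Φᴴ - (Ψ + z * Q) * Ψᴴ = 1 := by
    have e : (Φ + z * P) * Φᴴ - (Ψ + z * Q) * Ψᴴ
        = (Φ * Φᴴ + Ψ * -Ψᴴ) + z * (P * Φᴴ + Q * -Ψᴴ) := by
      noncomm_ring
    rw [e, a1, a3]
    simp
  generalize Φ + z * P = A at *
  generalize Ψ + z * Q = B at *
  have hU : IsUnit A := by
    rw [← vecMul_injective_iff_isUnit]
    rw [← coe_vecMulLinear, injective_iff_map_eq_zero]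
    intro v hv
    rw [vecMulLinear_apply] at hv
    have hb : v ᵥ* B = 0 := by
      rw [← vecMul_self_mul_conjTranspose_eq_zero, ← hA, ← vecMul_vecMul, hv, zero_vecMul]
    have := congrArg (fun M => v ᵥ* M) hC
    simpa [vecMul_sub, ← vecMul_vecMul, hv, hb] using this.symm
  have hd : IsUnit A.det := (isUnit_iff_isUnit_det A).mp hU
  have hd1 : A⁻¹ * A = 1 := nonsing_inv_mul A hd
  refine ⟨hU, ?_, ?_⟩
  · rw [mul_eq_one_comm, conjTranspose_mul]
    calc A⁻¹ * B * (Bᴴ * A⁻¹ᴴ) = A⁻¹ * (B * Bᴴ) * A⁻¹ᴴ := by simp only [mul_assoc]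
      _ = (A⁻¹ * A) * (A⁻¹ * A)ᴴ := by rw [← hA, conjTranspose_mul]; simp only [mul_assoc]
      _ = 1 := by rw [hd1]; simp
  · rw [transpose_mul]
    calc Bᵀ * A⁻¹ᵀ = (A⁻¹ * A) * Bᵀ * A⁻¹ᵀ := by rw [hd1, one_mul]
      _ = A⁻¹ * (A * Bᵀ) * A⁻¹ᵀ := by simp only [mul_assoc]
      _ = A⁻¹ * B * (A⁻¹ * A)ᵀ := by rw [hB, transpose_mul]; simp only [mul_assoc]
      _ = A⁻¹ * B := by rw [hd1]; simp

/-- For `z` symmetric unitary and `g = [[Φ,Ψ],[conj Ψ, conj Φ]] ∈ Sp(2n,ℝ)` (preserving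
both the Hermitian form `diag(1,−1)` and the skew form `[[0,1],[−1,0]]`), the matrix
`Φ + z·conj Ψ` is invertible and `(Φ + z·conj Ψ)⁻¹(Ψ + z·conj Φ)` is symmetric unitary. -/
theorem stmt15 (n : ℕ) (hn : 1 ≤ n) (z Φ Ψ : Matrix (Fin n) (Fin n) ℂ)
    (hzu : zᴴ * z = 1) (hzs : zᵀ = z)
    (hg1 : (fromBlocks Φ Ψ (Ψ.map (starRingEnd ℂ)) (Φ.map (starRingEnd ℂ)))ᴴ
          * fromBlocks 1 0 0 (-1)
          * fromBlocks Φ Ψ (Ψ.map (starRingEnd ℂ)) (Φ.map (starRingEnd ℂ))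
        = fromBlocks (1 : Matrix (Fin n) (Fin n) ℂ) 0 0 (-1))
    (hg2 : (fromBlocks Φ Ψ (Ψ.map (starRingEnd ℂ)) (Φ.map (starRingEnd ℂ)))ᵀ
          * fromBlocks 0 1 (-1) 0
          * fromBlocks Φ Ψ (Ψ.map (starRingEnd ℂ)) (Φ.map (starRingEnd ℂ))
        = fromBlocks 0 (1 : Matrix (Fin n) (Fin n) ℂ) (-1) 0) :
    IsUnit (Φ + z * Ψ.map (starRingEnd ℂ))
    ∧ ((Φ + z * Ψ.map (starRingEnd ℂ))⁻¹ * (Ψ + z * Φ.map (starRingEnd ℂ)))ᴴ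
        * ((Φ + z * Ψ.map (starRingEnd ℂ))⁻¹ * (Ψ + z * Φ.map (starRingEnd ℂ))) = 1
    ∧ ((Φ + z * Ψ.map (starRingEnd ℂ))⁻¹ * (Ψ + z * Φ.map (starRingEnd ℂ)))ᵀ
        = (Φ + z * Ψ.map (starRingEnd ℂ))⁻¹ * (Ψ + z * Φ.map (starRingEnd ℂ)) := by
  exact stmt15_aux n z Φ Ψ _ _ hzu hzs hg1 hg2
end

section
/- Let n ≥ 1, let z be a 2n×2n complex matrix that is unitary (z⋆z = 1) and skew-symmetric (z = −zᵗ), and let g = [[Φ,Ψ],[−conj(Ψ),conj(Φ)]] be a (2n+2n)×(2n+2n) complex block matrix (with 2n×2n blocks) satisfying g⋆ · diag(1_{2n}, −1_{2n}) · g = diag(1_{2n}, −1_{2n}) and gᵗ · [[0,1_{2n}],[1_{2n},0]] · g = [[0,1_{2n}],[1_{2n},0]]. Then Φ − z·conj(Ψ) is invertible and the matrix (Φ − z·conj(Ψ))⁻¹ · (Ψ + z·conj(Φ)) is unitary and skew-symmetric. -/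
open Matrix

theorem aux_core {m : Type} [Fintype m] [DecidableEq m] (z P Q Pc Qc : Matrix m m ℂ)
    (hzu : zᴴ * z = 1) (hzs : zᵀ = -z)
    (hg1 : (fromBlocks P Q (-Qc) Pc)ᴴ * fromBlocks 1 0 0 (-1) * fromBlocks P Q (-Qc) Pc
        = fromBlocks (1 : Matrix m m ℂ) 0 0 (-1 : Matrix m m ℂ))
    (hg2 : (fromBlocks P Q (-Qc) Pc)ᵀ * fromBlocks 0 1 1 0 * fromBlocks P Q (-Qc) Pc
        = fromBlocks 0 (1 : Matrix m m ℂ) 1 0) :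
    IsUnit (P - z * Qc)
    ∧ ((P - z * Qc)⁻¹ * (Q + z * Pc))ᴴ * ((P - z * Qc)⁻¹ * (Q + z * Pc)) = 1
    ∧ ((P - z * Qc)⁻¹ * (Q + z * Pc))ᵀ = -((P - z * Qc)⁻¹ * (Q + z * Pc)) := by
  have hzu' : z * zᴴ = 1 := mul_eq_one_comm.mp hzu
  have hJJ : fromBlocks (1 : Matrix m m ℂ) 0 0 (-1 : Matrix m m ℂ)
      * fromBlocks (1 : Matrix m m ℂ) 0 0 (-1 : Matrix m m ℂ) = 1 := by
    simp [fromBlocks_multiply]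
  have hSS : fromBlocks (0 : Matrix m m ℂ) (1 : Matrix m m ℂ) (1 : Matrix m m ℂ) (0 : Matrix m m ℂ)
      * fromBlocks (0 : Matrix m m ℂ) (1 : Matrix m m ℂ) (1 : Matrix m m ℂ) (0 : Matrix m m ℂ) = 1 := by
    simp [fromBlocks_multiply]
  have k1 : fromBlocks P Q (-Qc) Pc * (fromBlocks (1 : Matrix m m ℂ) 0 0 (-1 : Matrix m m ℂ) *
      ((fromBlocks P Q (-Qc) Pc)ᴴ * fromBlocks (1 : Matrix m m ℂ) 0 0 (-1 : Matrix m m ℂ))) = 1 := by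
    rw [mul_eq_one_comm, Matrix.mul_assoc, hg1, hJJ]
  have k2 : fromBlocks P Q (-Qc) Pc * (fromBlocks 0 (1 : Matrix m m ℂ) 1 0 *
      ((fromBlocks P Q (-Qc) Pc)ᵀ * fromBlocks 0 (1 : Matrix m m ℂ) 1 0)) = 1 := by
    rw [mul_eq_one_comm, Matrix.mul_assoc, hg2, hSS]
  rw [← fromBlocks_one] at k1 k2
  simp only [fromBlocks_conjTranspose, fromBlocks_transpose, fromBlocks_multiply, fromBlocks_inj,
    Matrix.mul_zero, Matrix.zero_mul, Matrix.mul_one, Matrix.one_mul, zero_add, add_zero,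
    Matrix.mul_neg, Matrix.neg_mul, conjTranspose_neg, transpose_neg, neg_neg, neg_zero] at k1 k2
  obtain ⟨a1, a2, a3, a4⟩ := k1
  obtain ⟨b1, b2, b3, b4⟩ := k2
  have hAP : (P - z * Qc) * Pᴴ - (Q + z * Pc) * Qᴴ = 1 := by
    have : (P - z * Qc) * Pᴴ - (Q + z * Pc) * Qᴴ
        = (P * Pᴴ + -(Q * Qᴴ)) + z * (-(Qc * Pᴴ) + -(Pc * Qᴴ)) := by noncomm_ring
    rw [this, a1, a3]; simp
  have hAB : (P - z * Qc) * (P - z * Qc)ᴴ = (Q + z * Pc) * (Q + z * Pc)ᴴ := by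
    have : (P - z * Qc) * (P - z * Qc)ᴴ - (Q + z * Pc) * (Q + z * Pc)ᴴ
        = (P * Pᴴ + -(Q * Qᴴ)) + z * (-(Qc * Pᴴ) + -(Pc * Qᴴ))
         - (P * Qcᴴ + Q * Pcᴴ) * zᴴ - z * (-(Qc * Qcᴴ) + Pc * Pcᴴ) * zᴴ := by
      simp only [conjTranspose_sub, conjTranspose_add, conjTranspose_mul]
      noncomm_ring
    rw [← sub_eq_zero, this, a1, a2, a3, a4]; simp [hzu']
  have hS : (P - z * Qc) * (Q + z * Pc)ᵀ + (Q + z * Pc) * (P - z * Qc)ᵀ = 0 := by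
    have : (P - z * Qc) * (Q + z * Pc)ᵀ + (Q + z * Pc) * (P - z * Qc)ᵀ
        = (P * Qᵀ + Q * Pᵀ) + (Q * -Qcᵀ + P * Pcᵀ) * zᵀ + z * (Pc * Pᵀ + -(Qc * Qᵀ))
          - z * (Qc * Pcᵀ + Pc * Qcᵀ) * zᵀ := by
      simp only [transpose_sub, transpose_add, transpose_mul]
      noncomm_ring
    have c1 : P * Qᵀ + Q * Pᵀ = 0 := by exact b2
    have c2 : Q * -Qcᵀ + P * Pcᵀ = 1 := by rw [← b1]; noncomm_ring
    have c3 : Pc * Pᵀ + -(Qc * Qᵀ) = 1 := by rw [← b4]; abel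
    have c4 : Qc * Pcᵀ + Pc * Qcᵀ = 0 := by rw [← neg_eq_zero, ← b3]; abel
    rw [this, c1, c2, c3, c4, hzs]; simp
  generalize P - z * Qc = A at *
  generalize Q + z * Pc = B at *
  have hA : IsUnit A := by
    rw [← Matrix.vecMul_injective_iff_isUnit]
    refine (injective_iff_map_eq_zero (Matrix.vecMulLinear A)).mpr ?_
    intro v hv
    change v ᵥ* A = 0 at hv
    have h1 : v ᵥ* (B * Bᴴ) = 0 := by rw [← hAB, ← vecMul_vecMul, hv, zero_vecMul]
    have h2 : v ᵥ* B = 0 := by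
      open scoped ComplexOrder in exact (vecMul_self_mul_conjTranspose_eq_zero B v).mp h1
    have h3 : v ᵥ* (A * Pᴴ - B * Qᴴ) = 0 := by
      rw [vecMul_sub, ← vecMul_vecMul, ← vecMul_vecMul, hv, h2]; simp
    simpa [hAP] using h3
  have hd : IsUnit A.det := (Matrix.isUnit_iff_isUnit_det A).mp hA
  have hAw : A * (A⁻¹ * B) = B := Matrix.mul_nonsing_inv_cancel_left A B hd
  generalize A⁻¹ * B = w at *
  subst hAw
  have hAH : IsUnit Aᴴ := by simpa [star_eq_conjTranspose] using hA.star
  have hAT : IsUnit Aᵀ := by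
    rw [Matrix.isUnit_iff_isUnit_det, det_transpose]; exact hd
  refine ⟨hA, ?_, ?_⟩
  · rw [mul_eq_one_comm]
    apply hA.mul_left_cancel
    apply hAH.mul_right_cancel
    rw [mul_one, hAB, conjTranspose_mul]
    noncomm_ring
  · rw [eq_neg_iff_add_eq_zero]
    apply hA.mul_left_cancel
    apply hAT.mul_right_cancel
    rw [mul_zero, zero_mul, ← hS, transpose_mul]
    noncomm_ring

/-- For `z` skew-symmetric unitary (`2n×2n`) and
`g = [[Φ,Ψ],[−conj Ψ, conj Φ]] ∈ SO*(4n)` (preserving both the Hermitian form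
`diag(1,−1)` and the symmetric form `[[0,1],[1,0]]`), the matrix `Φ − z·conj Ψ` is
invertible and `(Φ − z·conj Ψ)⁻¹(Ψ + z·conj Φ)` is skew-symmetric unitary. -/
theorem stmt16 (n : ℕ) (hn : 1 ≤ n) (z Φ Ψ : Matrix (Fin (2 * n)) (Fin (2 * n)) ℂ)
    (hzu : zᴴ * z = 1) (hzs : zᵀ = -z)
    (hg1 : (fromBlocks Φ Ψ (-(Ψ.map (starRingEnd ℂ))) (Φ.map (starRingEnd ℂ)))ᴴ
          * fromBlocks 1 0 0 (-1)
          * fromBlocks Φ Ψ (-(Ψ.map (starRingEnd ℂ))) (Φ.map (starRingEnd ℂ))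
        = fromBlocks (1 : Matrix (Fin (2 * n)) (Fin (2 * n)) ℂ) 0 0 (-1))
    (hg2 : (fromBlocks Φ Ψ (-(Ψ.map (starRingEnd ℂ))) (Φ.map (starRingEnd ℂ)))ᵀ
          * fromBlocks 0 1 1 0
          * fromBlocks Φ Ψ (-(Ψ.map (starRingEnd ℂ))) (Φ.map (starRingEnd ℂ))
        = fromBlocks 0 (1 : Matrix (Fin (2 * n)) (Fin (2 * n)) ℂ) 1 0) :
    IsUnit (Φ - z * Ψ.map (starRingEnd ℂ))
    ∧ ((Φ - z * Ψ.map (starRingEnd ℂ))⁻¹ * (Ψ + z * Φ.map (starRingEnd ℂ)))ᴴ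
        * ((Φ - z * Ψ.map (starRingEnd ℂ))⁻¹ * (Ψ + z * Φ.map (starRingEnd ℂ))) = 1
    ∧ ((Φ - z * Ψ.map (starRingEnd ℂ))⁻¹ * (Ψ + z * Φ.map (starRingEnd ℂ)))ᵀ
        = -((Φ - z * Ψ.map (starRingEnd ℂ))⁻¹ * (Ψ + z * Φ.map (starRingEnd ℂ))) := by
  exact aux_core z Φ Ψ _ _ hzu hzs hg1 hg2
end

section
/- Let n ≥ 1 and let z be an n×n complex matrix that is unitary (z⋆z = 1) and symmetric (z = zᵗ). Then there exists a unitary n×n matrix h such that z = hᵗ·h. Equivalently, the action of U(n) on the set of symmetric unitary matrices by z ↦ hᵗ·z·h is transitive, so this set is the homogeneous space U(n)/O(n). -/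
open Matrix

open scoped Matrix.Norms.L2Operator in
/-- A unitary matrix has a unitary square root that is a polynomial in it. -/
theorem exists_unitary_sqrt_aux (n : ℕ) (z : Matrix (Fin n) (Fin n) ℂ)
    (hzu : zᴴ * z = 1) :
    ∃ p : Polynomial ℂ, (Polynomial.aeval z p)ᴴ * (Polynomial.aeval z p) = 1 ∧
      Polynomial.aeval z p * Polynomial.aeval z p = z := by
  letI : CStarAlgebra (Matrix (Fin n) (Fin n) ℂ) := { }
  have hzu2 : z * zᴴ = 1 := mul_eq_one_comm.mp hzu
  have hU : z ∈ unitary (Matrix (Fin n) (Fin n) ℂ) := ⟨hzu, hzu2⟩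
  have hN : IsStarNormal z := ⟨by
    change zᴴ * z = z * zᴴ
    rw [hzu, hzu2]⟩
  have hfin : (spectrum ℂ z).Finite := Matrix.finite_spectrum z
  let f : ℂ → ℂ := fun x => x ^ ((2 : ℕ) : ℂ)⁻¹
  have hf : ∀ x, f x * f x = x := fun x => by
    have := Complex.cpow_nat_inv_pow x (n := 2) (by norm_num)
    rw [← pow_two]; exact this
  let p : Polynomial ℂ := Lagrange.interpolate hfin.toFinset id f
  have hp : ∀ x ∈ spectrum ℂ z, p.eval x = f x := fun x hx =>
    Lagrange.eval_interpolate_at_node (v := id) f (Function.injective_id.injOn)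
      (hfin.mem_toFinset.mpr hx)
  have hpp : ∀ x ∈ spectrum ℂ z, p.eval x * p.eval x = x := fun x hx => by
    rw [hp x hx, hf]
  have hc : ContinuousOn (fun x => p.eval x) (spectrum ℂ z) := by fun_prop
  have hh : Polynomial.aeval z p = cfc (fun x => p.eval x) z := (cfc_polynomial p z).symm
  refine ⟨p, ?_, ?_⟩
  · rw [hh]
    change star (cfc (fun x => p.eval x) z) * _ = 1
    rw [← cfc_star, ← cfc_mul _ _ z (by fun_prop) hc, ← cfc_one ℂ z]
    refine cfc_congr fun x hx => ?_
    have hx1 : ‖x‖ = 1 := by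
      have := spectrum.subset_circle_of_unitary hU hx
      simpa using this
    have h1 : ‖p.eval x‖ * ‖p.eval x‖ = 1 := by rw [← norm_mul, hpp x hx, hx1]
    have h2 : star (p.eval x) * p.eval x = 1 := by
      rw [Complex.star_def, Complex.conj_mul', pow_two]
      exact_mod_cast h1
    simpa using h2
  · rw [hh, ← cfc_mul _ _ z hc hc]
    conv_rhs => rw [← cfc_id ℂ z]
    exact cfc_congr fun x hx => hpp x hx

/-- Every symmetric unitary matrix `z` can be written as `z = hᵗ·h` with `h` unitary;
equivalently, `U(n)` acts transitively on symmetric unitary matrices by `z ↦ hᵗzh`,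
so this set is the homogeneous space `U(n)/O(n)`. -/
theorem stmt17 (n : ℕ) (hn : 1 ≤ n) (z : Matrix (Fin n) (Fin n) ℂ)
    (hzu : zᴴ * z = 1) (hzs : zᵀ = z) :
    ∃ h : Matrix (Fin n) (Fin n) ℂ, hᴴ * h = 1 ∧ z = hᵀ * h := by
  obtain ⟨p, h1, h2⟩ := exists_unitary_sqrt_aux n z hzu
  refine ⟨_, h1, ?_⟩
  have ht : (Polynomial.aeval z p)ᵀ = Polynomial.aeval z p := by
    rw [Polynomial.aeval_eq_sum_range, Matrix.transpose_sum]
    simp [Matrix.transpose_smul, Matrix.transpose_pow, hzs]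
  rw [ht, h2]
end

section
/- Let n ≥ 1, let J be the 2n×2n block matrix [[0,1ₙ],[−1ₙ,0]], and let z be a 2n×2n complex matrix that is unitary (z⋆z = 1) and skew-symmetric (z = −zᵗ). Then there exists a unitary 2n×2n matrix h such that z = hᵗ·J·h. Equivalently, the action of U(2n) on the set of 2n×2n skew-symmetric unitary matrices by z ↦ hᵗ·z·h is transitive, so this set is the homogeneous space U(2n)/Sp(n). -/
open Matrix

lemma stmt18_aux (n : ℕ)
    (z : Matrix (Fin n ⊕ Fin n) (Fin n ⊕ Fin n) ℂ) (hzs : zᵀ = -z) (k : ℕ) (hk : k ≤ n) :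
    ∃ a : Fin k → (Fin n ⊕ Fin n → ℂ),
      (∀ i j, star (a i) ⬝ᵥ a j = if i = j then 1 else 0) ∧
      (∀ i j, a i ⬝ᵥ (z *ᵥ a j) = 0) := by
  have skew : ∀ v w : Fin n ⊕ Fin n → ℂ, v ⬝ᵥ (z *ᵥ w) = -(w ⬝ᵥ (z *ᵥ v)) := by
    intro v w
    rw [dotProduct_comm, ← dotProduct_neg, ← neg_mulVec, ← hzs, mulVec_transpose,
      dotProduct_comm w, dotProduct_comm, ← dotProduct_mulVec, dotProduct_comm,
      dotProduct_comm]
  have skew0 : ∀ v : Fin n ⊕ Fin n → ℂ, v ⬝ᵥ (z *ᵥ v) = 0 := by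
    intro v
    exact self_eq_neg.mp (skew v v)
  induction k with
  | zero => exact ⟨fun _ => 0, fun i => i.elim0, fun i => i.elim0⟩
  | succ k ih =>
    obtain ⟨a, h1, h2⟩ := ih (by omega)
    let M : Matrix (Fin k ⊕ Fin k) (Fin n ⊕ Fin n) ℂ :=
      Matrix.of (Sum.elim (fun i => star (a i)) (fun i => (a i) ᵥ* z))
    have hker : LinearMap.ker (M.mulVecLin) ≠ ⊥ := by
      apply LinearMap.ker_ne_bot_of_finrank_lt
      simp; omega
    obtain ⟨v, hv, hv0⟩ := (Submodule.ne_bot_iff _).mp hker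
    have hMv : M *ᵥ v = 0 := by simpa using hv
    have e1 : ∀ i, star (a i) ⬝ᵥ v = 0 := fun i => congrFun hMv (Sum.inl i)
    have e2 : ∀ i, a i ⬝ᵥ (z *ᵥ v) = 0 := fun i => by
      rw [dotProduct_mulVec]; exact congrFun hMv (Sum.inr i)
    obtain ⟨c, hc⟩ : ∃ c : ℂ, star c * c * (star v ⬝ᵥ v) = 1 := by
      have hs : star v ⬝ᵥ v = ((∑ i, ‖v i‖ ^ 2 : ℝ) : ℂ) := by
        simp [dotProduct, Complex.conj_mul']
      have hne : star v ⬝ᵥ v ≠ 0 := fun h => hv0 (by open ComplexOrder in exact dotProduct_star_self_eq_zero.mp h)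
      rw [hs] at hne ⊢
      set r : ℝ := ∑ i, ‖v i‖ ^ 2
      have hr : 0 ≤ r := by positivity
      refine ⟨((Real.sqrt r)⁻¹ : ℝ), ?_⟩
      have hr0 : r ≠ 0 := by exact_mod_cast hne
      have : (Real.sqrt r)⁻¹ * (Real.sqrt r)⁻¹ * r = 1 := by
        rw [← mul_inv, Real.mul_self_sqrt hr, inv_mul_cancel₀ hr0]
      simp only [Complex.star_def, Complex.conj_ofReal]
      exact_mod_cast this
    have e3 : ∀ i, star v ⬝ᵥ a i = 0 := fun i => by
      have := congrArg star (e1 i)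
      rwa [star_dotProduct, star_zero, star_star] at this
    refine ⟨Fin.cons (c • v) a, ?_, ?_⟩
    · intro i j
      refine Fin.cases ?_ (fun i => ?_) i <;> refine Fin.cases ?_ (fun j => ?_) j
      · simp only [Fin.cons_zero, star_smul, smul_dotProduct, dotProduct_smul, smul_eq_mul, if_true]
        rw [← hc]; ring
      · simp [e3, (Fin.succ_ne_zero _).symm]
      · simp [e1]
      · simp [h1]
    · intro i j
      refine Fin.cases ?_ (fun i => ?_) i <;> refine Fin.cases ?_ (fun j => ?_) j
      · simp [mulVec_smul, skew0]
      · simp [skew v, e2]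
      · simp [mulVec_smul, e2]
      · simp [h2]

/-- Every skew-symmetric unitary `2n×2n` matrix `z` can be written as `z = hᵗ·J·h` with
`h` unitary and `J = [[0,1],[−1,0]]`; equivalently, `U(2n)` acts transitively on
skew-symmetric unitary matrices by `z ↦ hᵗzh`, so this set is `U(2n)/Sp(n)`. -/
theorem stmt18 (n : ℕ) (hn : 1 ≤ n)
    (z : Matrix (Fin n ⊕ Fin n) (Fin n ⊕ Fin n) ℂ)
    (hzu : zᴴ * z = 1) (hzs : zᵀ = -z) :
    ∃ h : Matrix (Fin n ⊕ Fin n) (Fin n ⊕ Fin n) ℂ,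
      hᴴ * h = 1 ∧ z = hᵀ * fromBlocks 0 (1 : Matrix (Fin n) (Fin n) ℂ) (-1) 0 * h := by
  obtain ⟨a, h1, h2⟩ := stmt18_aux n z hzs n le_rfl
  have hzu' : z * zᴴ = 1 := mul_eq_one_comm.mp hzu
  obtain ⟨A, hA1, hA2⟩ : ∃ A : Matrix (Fin n ⊕ Fin n) (Fin n) ℂ,
      Aᴴ * A = 1 ∧ Aᵀ * z * A = 0 := by
    refine ⟨(Matrix.of a)ᵀ, ?_, ?_⟩
    · ext i j
      rw [Matrix.one_apply, ← h1 i j]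
      rfl
    · ext i j
      rw [Matrix.zero_apply, ← h2 i j, Matrix.mul_assoc]
      rfl
  have hA3 : Aᴴ * zᴴ * Aᴴᵀ = 0 := by
    have := congrArg conjTranspose hA2
    rw [conjTranspose_mul, conjTranspose_mul, conjTranspose_zero, ← Matrix.mul_assoc] at this
    exact this
  have hA4 : Aᵀ * Aᴴᵀ = 1 := by
    rw [← transpose_mul, hA1, transpose_one]
  have hzc : zᴴᵀ = -zᴴ := by
    have := congrArg conjTranspose hzs
    rw [conjTranspose_neg] at this
    rw [← this]; rfl
  have hBH : (zᴴ * Aᴴᵀ)ᴴ = Aᵀ * z := by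
    rw [conjTranspose_mul, conjTranspose_conjTranspose]
    congr 1
    ext i j; simp
  have hBT : (zᴴ * Aᴴᵀ)ᵀ = -(Aᴴ * zᴴ) := by
    rw [transpose_mul, hzc, transpose_transpose, Matrix.mul_neg]
  let u : Matrix (Fin n ⊕ Fin n) (Fin n ⊕ Fin n) ℂ := fromCols A (zᴴ * Aᴴᵀ)
  have q1 : Aᵀ * z * (zᴴ * Aᴴᵀ) = 1 := by
    rw [Matrix.mul_assoc, ← Matrix.mul_assoc z, hzu', Matrix.one_mul, hA4]
  have q2 : Aᴴ * zᴴ * z = Aᴴ := by rw [Matrix.mul_assoc, hzu, Matrix.mul_one]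
  have hu : uᴴ * u = 1 := by
    simp only [u]
    rw [conjTranspose_fromCols_eq_fromRows_conjTranspose, fromRows_mul_fromCols, hBH, hA1, hA2, q1,
      ← Matrix.mul_assoc, hA3, fromBlocks_one]
  have hJ : uᵀ * z * u = fromBlocks 0 (1 : Matrix (Fin n) (Fin n) ℂ) (-1) 0 := by
    simp only [u]
    rw [transpose_fromCols, fromRows_mul, fromRows_mul_fromCols, hBT, hA2, q1]
    rw [Matrix.neg_mul, q2, Matrix.neg_mul, Matrix.neg_mul, hA1, ← Matrix.mul_assoc, hA3, neg_zero]
  have hu' : u * uᴴ = 1 := mul_eq_one_comm.mp hu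
  refine ⟨uᴴ, by rw [conjTranspose_conjTranspose, hu'], ?_⟩
  have ht : uᴴᵀ * uᵀ = 1 := by rw [← transpose_mul, hu', transpose_one]
  rw [← hJ]
  calc z = (uᴴᵀ * uᵀ) * z * (u * uᴴ) := by rw [ht, hu', Matrix.one_mul, Matrix.mul_one]
    _ = _ := by simp only [Matrix.mul_assoc]
end
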